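/- Let m ∈ ℕ, let Σ be a finite alphabet, and let L_1, L_2 ⊆ Σ* both be recognized by a monoid homomorphism φ : Σ* → M into a finite monoid M (i.e. L_i = φ^{-1}(φ(L_i)) for i = 1, 2). Then L_1 and L_2 are not separable by R_m if and only if there exist π-terms α and β over Σ such that [α]_{ω+ω*} ≡_m^X [β]_{ω+ω*}, [α]_{M!} ∈ L_1, and [β]_{M!} ∈ L_2. -/

import Mathlib

open scoped Classical

/-! ## Generalized words -/

structure GWord (A : Type) : Type 1 where
  P : Type
  ord : LinearOrder P
  w : P → A

namespace GWord

variable {A : Type}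

instance (u : GWord A) : LinearOrder u.P := u.ord

/-- The set of letters occurring in a generalized word. -/
def alph (u : GWord A) : Set A := Set.range u.w

/-- Restriction of a generalized word to a set of positions. -/
def restrict (u : GWord A) (s : Set u.P) : GWord A :=
  ⟨{ p // p ∈ s }, inferInstance, fun p => u.w p.1⟩

/-- `p` is the first `a`-labelled position of `u`. -/
def IsFirst (u : GWord A) (a : A) (p : u.P) : Prop :=
  u.w p = a ∧ ∀ q : u.P, u.w q = a → p ≤ q

/-- `p` is the last `a`-labelled position of `u`. -/
def IsLast (u : GWord A) (a : A) (p : u.P) : Prop :=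
  u.w p = a ∧ ∀ q : u.P, u.w q = a → q ≤ p

/-- The factor strictly before the first occurrence of `a`. -/
noncomputable def XL (u : GWord A) (a : A) : GWord A :=
  if h : ∃ p, u.IsFirst a p then u.restrict {q | q < h.choose} else u

/-- The factor strictly after the first occurrence of `a`. -/
noncomputable def XR (u : GWord A) (a : A) : GWord A :=
  if h : ∃ p, u.IsFirst a p then u.restrict {q | h.choose < q} else u

/-- The factor strictly before the last occurrence of `a`. -/
noncomputable def YL (u : GWord A) (a : A) : GWord A :=
  if h : ∃ p, u.IsLast a p then u.restrict {q | q < h.choose} else u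

/-- The factor strictly after the last occurrence of `a`. -/
noncomputable def YR (u : GWord A) (a : A) : GWord A :=
  if h : ∃ p, u.IsLast a p then u.restrict {q | h.choose < q} else u

/-- `C_{a,b}` is defined iff the first `a` is strictly to the right of the last `b`. -/
def CDefined (u : GWord A) (a b : A) : Prop :=
  ∃ p q, u.IsFirst a p ∧ u.IsLast b q ∧ q < p

/-- The factor strictly between the last `b` and the first `a` (junk value if undefined). -/
noncomputable def Cab (u : GWord A) (a b : A) : GWord A :=
  if h : u.CDefined a b then
    u.restrict {r | h.choose_spec.choose < r ∧ r < h.choose}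
  else u

/-- Accessibility: first/last occurrences of letters after/before every position exist. -/
def Accessible (u : GWord A) : Prop :=
  (∀ a : A, (∃ p, u.w p = a) → ∃ p, u.IsFirst a p) ∧
  (∀ a : A, (∃ p, u.w p = a) → ∃ p, u.IsLast a p) ∧
  (∀ (p : u.P) (a : A), (∃ q, p < q ∧ u.w q = a) →
    ∃ q, p < q ∧ u.w q = a ∧ ∀ r, p < r → u.w r = a → q ≤ r) ∧
  (∀ (p : u.P) (a : A), (∃ q, q < p ∧ u.w q = a) →
    ∃ q, q < p ∧ u.w q = a ∧ ∀ r, r < p → u.w r = a → r ≤ q)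

/-- Concatenation of generalized words. -/
def append (u v : GWord A) : GWord A :=
  ⟨u.P ⊕ₗ v.P, inferInstance, fun x => Sum.elim u.w v.w (ofLex x)⟩

/-- The power of a generalized word by an arbitrary linear order type `ν`
(positions ordered with the exponent component dominant). -/
def gpow (u : GWord A) (ν : Type) [LinearOrder ν] : GWord A :=
  ⟨ν ×ₗ u.P, inferInstance, fun x => u.w (ofLex x).2⟩

/-- A finite word as a generalized word. -/
def ofList (l : List A) : GWord A :=
  ⟨Fin l.length, inferInstance, fun i => l.get i⟩

end GWord

/-- The order type `ω + ω*`: a copy of `ℕ` followed by a reversed copy of `ℕ`. -/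
abbrev OO : Type := ℕ ⊕ₗ ℕᵒᵈ

/-! ## The relations `≡_{m,n}^Z` -/

inductive ZK : Type
  | X | Y | WI

inductive ZKind : Type
  | X | Y | XY | WI

/-- The relations `≡_{m,n}^X`, `≡_{m,n}^Y`, `≡_{m,n}^{WI}` (first argument is `n`). -/
def eqvAux {A : Type} : ℕ → ZK → ℕ → GWord A → GWord A → Prop
  | 0, _, _, _, _ => True
  | _ + 1, _, 0, _, _ => True
  | n + 1, ZK.X, m + 1, u, v =>
      u.alph = v.alph ∧ eqvAux n ZK.Y m u v ∧
      ∀ a ∈ u.alph, eqvAux n ZK.Y m (u.XL a) (v.XL a) ∧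
        eqvAux n ZK.X (m + 1) (u.XR a) (v.XR a)
  | n + 1, ZK.Y, m + 1, u, v =>
      u.alph = v.alph ∧ eqvAux n ZK.X m u v ∧
      ∀ a ∈ u.alph, eqvAux n ZK.Y (m + 1) (u.YL a) (v.YL a) ∧
        eqvAux n ZK.X m (u.YR a) (v.YR a)
  | n + 1, ZK.WI, m + 1, u, v =>
      u.alph = v.alph ∧
      (∀ a ∈ u.alph,
        eqvAux n ZK.WI m (u.XL a) (v.XL a) ∧ eqvAux n ZK.WI (m + 1) (u.XR a) (v.XR a) ∧
        eqvAux n ZK.WI (m + 1) (u.YL a) (v.YL a) ∧ eqvAux n ZK.WI m (u.YR a) (v.YR a)) ∧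
      ∀ a ∈ u.alph, ∀ b ∈ u.alph,
        (u.CDefined a b ↔ v.CDefined a b) ∧
        (u.CDefined a b → v.CDefined a b → eqvAux n ZK.WI m (u.Cab a b) (v.Cab a b))

/-- `wEquiv Z m n u v` is `u ≡_{m,n}^Z v`. -/
def wEquiv {A : Type} (Z : ZKind) (m n : ℕ) (u v : GWord A) : Prop :=
  match Z with
  | ZKind.X => eqvAux n ZK.X m u v
  | ZKind.Y => eqvAux n ZK.Y m u v
  | ZKind.XY => eqvAux n ZK.X m u v ∧ eqvAux n ZK.Y m u v
  | ZKind.WI => eqvAux n ZK.WI m u v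

/-! ## π-terms -/

inductive PiTerm (A : Type) : Type
  | eps : PiTerm A
  | letter : A → PiTerm A
  | mul : PiTerm A → PiTerm A → PiTerm A
  | pi : PiTerm A → PiTerm A

def listNPow {A : Type} (l : List A) : ℕ → List A
  | 0 => []
  | k + 1 => l ++ listNPow l k

/-- `[γ]_k`: substitute the natural number `k` for the formal power `π`. -/
def PiTerm.substNat {A : Type} : PiTerm A → ℕ → List A
  | .eps, _ => []
  | .letter a, _ => [a]
  | .mul α β, k => α.substNat k ++ β.substNat k
  | .pi γ, k => listNPow (γ.substNat k) k

/-- `[γ]_{ω+ω*}`: substitute the order type `ω + ω*` for the formal power `π`. -/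
def PiTerm.substOO {A : Type} : PiTerm A → GWord A
  | .eps => GWord.ofList []
  | .letter a => GWord.ofList [a]
  | .mul α β => α.substOO.append β.substOO
  | .pi γ => γ.substOO.gpow OO

/-! ## Finite monoids, equations, the Trotter–Weil hierarchy -/

/-- `M!`: the exponent of a finite monoid, the least `n ≥ 1` such that all `x^n` are
idempotent. -/
noncomputable def monoidExp (M : Type) [Monoid M] : ℕ :=
  sInf {n : ℕ | 1 ≤ n ∧ ∀ x : M, IsIdempotentElem (x ^ n)}

/-- The equation `α = β` of π-terms holds in the finite monoid `M`. -/
def EqHoldsIn {A : Type} (α β : PiTerm A) (M : Type) [Monoid M] : Prop :=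
  ∀ σ : FreeMonoid A →* M,
    σ (FreeMonoid.ofList (α.substNat (monoidExp M))) =
      σ (FreeMonoid.ofList (β.substNat (monoidExp M)))

/-- Green's relation `R`: `x R y` iff `xM = yM`. -/
def rGreen {M : Type} [Monoid M] (x y : M) : Prop :=
  Set.range (fun z => x * z) = Set.range (fun z => y * z)

/-- Green's relation `L`: `x L y` iff `Mx = My`. -/
def lGreen {M : Type} [Monoid M] (x y : M) : Prop :=
  Set.range (fun z => z * x) = Set.range (fun z => z * y)

/-- `J`-triviality: `MxM = MyM` implies `x = y`. -/
def IsJTrivial (M : Type) [Monoid M] : Prop :=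
  ∀ x y : M, {z | ∃ a b, z = a * x * b} = {z | ∃ a b, z = a * y * b} → x = y

/-- The relation `∼_K`. -/
def simK {M : Type} [Monoid M] (x y : M) : Prop :=
  ∀ e : M, IsIdempotentElem e → (rGreen (e * x) e ∨ rGreen (e * y) e) → e * x = e * y

/-- The relation `∼_D`. -/
def simD {M : Type} [Monoid M] (x y : M) : Prop :=
  ∀ e : M, IsIdempotentElem e → (lGreen (x * e) e ∨ lGreen (y * e) e) → x * e = y * e

/-- `∼_K` as a congruence (it is a congruence, so `conGen` does not change it). -/
def KCon (M : Type) [Monoid M] : Con M := conGen simK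

/-- `∼_D` as a congruence. -/
def DCon (M : Type) [Monoid M] : Con M := conGen simD

/-- `InRLAux k true M _ = (M ∈ R_{k+1})` and `InRLAux k false M _ = (M ∈ L_{k+1})`. -/
def InRLAux : ℕ → Bool → (M : Type) → Monoid M → Prop
  | 0, _, M, i => letI := i; IsJTrivial M
  | k + 1, true, M, i => letI := i; InRLAux k false (KCon M).Quotient inferInstance
  | k + 1, false, M, i => letI := i; InRLAux k true (DCon M).Quotient inferInstance

/-- `M ∈ R_m` (for `m ≥ 1`). -/
def InRm (m : ℕ) (M : Type) [i : Monoid M] : Prop := InRLAux (m - 1) true M i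

/-- `M ∈ L_m` (for `m ≥ 1`). -/
def InLm (m : ℕ) (M : Type) [i : Monoid M] : Prop := InRLAux (m - 1) false M i

/-- `N` divides `M`: `N` is a homomorphic image of a submonoid of `M`. -/
def MDivides (N M : Type) [Monoid N] [Monoid M] : Prop :=
  ∃ (S : Submonoid M) (f : S →* N), Function.Surjective f

/-- `N ∈ R_m ∨ L_m`: `N` divides a direct product `M₁ × M₂` with `M₁ ∈ R_m`, `M₂ ∈ L_m`. -/
def InJoin (m : ℕ) (N : Type) [Monoid N] : Prop :=
  ∃ (M₁ M₂ : Type) (i₁ : Monoid M₁) (i₂ : Monoid M₂),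
    letI := i₁; letI := i₂;
    Finite M₁ ∧ Finite M₂ ∧ InRm m M₁ ∧ InLm m M₂ ∧ MDivides N (M₁ × M₂)

/-- `M ∈ DA`, via the equation `(xyz)^{M!} y (xyz)^{M!} = (xyz)^{M!}`. -/
def InDA (M : Type) [Monoid M] : Prop :=
  ∀ x y z : M,
    (x * y * z) ^ monoidExp M * y * (x * y * z) ^ monoidExp M = (x * y * z) ^ monoidExp M

/-! ## The π-terms `U_m`, `V_m` -/

inductive UVLetter : Type
  | s | t | x (i : ℕ) | y (i : ℕ)

/-- `U_m` (indexed from 1; `Uterm 0` is a junk value). -/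
def Uterm : ℕ → PiTerm UVLetter
  | 0 => PiTerm.eps
  | 1 =>
      PiTerm.mul
        (PiTerm.pi (PiTerm.mul (PiTerm.letter UVLetter.s) (PiTerm.letter (UVLetter.x 1))))
        (PiTerm.mul (PiTerm.letter UVLetter.s)
          (PiTerm.pi (PiTerm.mul (PiTerm.letter (UVLetter.y 1)) (PiTerm.letter UVLetter.t))))
  | m + 2 =>
      PiTerm.mul
        (PiTerm.pi (PiTerm.mul (Uterm (m + 1)) (PiTerm.letter (UVLetter.x (m + 2)))))
        (PiTerm.mul (Uterm (m + 1))
          (PiTerm.pi (PiTerm.mul (PiTerm.letter (UVLetter.y (m + 2))) (Uterm (m + 1)))))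

/-- `V_m` (indexed from 1; `Vterm 0` is a junk value). -/
def Vterm : ℕ → PiTerm UVLetter
  | 0 => PiTerm.eps
  | 1 =>
      PiTerm.mul
        (PiTerm.pi (PiTerm.mul (PiTerm.letter UVLetter.s) (PiTerm.letter (UVLetter.x 1))))
        (PiTerm.mul (PiTerm.letter UVLetter.t)
          (PiTerm.pi (PiTerm.mul (PiTerm.letter (UVLetter.y 1)) (PiTerm.letter UVLetter.t))))
  | m + 2 =>
      PiTerm.mul
        (PiTerm.pi (PiTerm.mul (Uterm (m + 1)) (PiTerm.letter (UVLetter.x (m + 2)))))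
        (PiTerm.mul (Vterm (m + 1))
          (PiTerm.pi (PiTerm.mul (PiTerm.letter (UVLetter.y (m + 2))) (Uterm (m + 1)))))

/-- The relation `≡_{m,n}^Z` on the free monoid `Σ*`, as a congruence
(it is a congruence, so `conGen` does not change it). -/
def eqvCon (A : Type) (Z : ZKind) (m n : ℕ) : Con (FreeMonoid A) :=
  conGen (fun u v => wEquiv Z m n (GWord.ofList u.toList) (GWord.ofList v.toList))
/-- `L₁` and `L₂` are separable by `R_m`. -/
def SeparableByRm (m : ℕ) {A : Type} (L₁ L₂ : Set (FreeMonoid A)) : Prop :=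
  ∃ (N : Type) (iN : Monoid N),
    letI := iN
    Finite N ∧ InRm m N ∧
      ∃ (ψ : FreeMonoid A →* N) (S : Set (FreeMonoid A)),
        S = ψ ⁻¹' (ψ '' S) ∧ L₁ ⊆ S ∧ L₂ ∩ S = ∅

/-! ## The relations `≡_{m,n}^X` on finite words -/

/-- The relation `≡_{m,n}^X` on finite words; `≡_{m,n}^Y` is its conjugate under reversal. -/
def LEqv {A : Type} : ℕ → ℕ → List A → List A → Prop
  | 0, _, _, _ => True
  | _ + 1, 0, _, _ => True
  | n + 1, m + 1, u, v =>
      (∀ a, a ∈ u ↔ a ∈ v) ∧ LEqv n m u.reverse v.reverse ∧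
      ∀ a w z w' z', u = w ++ a :: z → a ∉ w → v = w' ++ a :: z' → a ∉ w' →
        LEqv n m w.reverse w'.reverse ∧ LEqv n (m + 1) z z'

namespace LEqv

variable {A : Type} {n m : ℕ} {u v u' v' : List A}

theorem zero_right (n : ℕ) (u v : List A) : LEqv n 0 u v := by
  cases n <;> trivial

theorem split_unique {a : A} {w z w' z' : List A} (h : w ++ a :: z = w' ++ a :: z')
    (hw : a ∉ w) (hw' : a ∉ w') : w = w' ∧ z = z' := by
  induction w generalizing w' with
  | nil =>
    cases w' with
    | nil => simpa using h
    | cons b w' => simp at h hw'; exact absurd h.1 hw'.1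
  | cons b w ih =>
    cases w' with
    | nil => simp at h hw; exact absurd h.1.symm hw.1
    | cons c w' =>
      simp only [List.cons_append, List.cons.injEq, List.mem_cons, not_or] at h hw hw'
      obtain ⟨rfl, rfl⟩ := ih h.2 hw.2 hw'.2
      exact ⟨by rw [h.1], rfl⟩

theorem exists_split {a : A} (h : a ∈ u) : ∃ w z, u = w ++ a :: z ∧ a ∉ w := by
  obtain ⟨w, z, h1, h2⟩ := List.eq_append_cons_of_mem h
  exact ⟨w, z, h1, h2⟩

/-- If the first `a` of `u ++ v` lies in `u`, the split of `u ++ v` at it restricts to `u`. -/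
theorem split_append_left {a : A} {w z : List A} (h : u ++ v = w ++ a :: z) (hw : a ∉ w)
    (ha : a ∈ u) : ∃ z₁, u = w ++ a :: z₁ ∧ z = z₁ ++ v := by
  obtain ⟨w₁, z₁, rfl, h1⟩ := exists_split ha
  obtain ⟨rfl, rfl⟩ := split_unique (by simpa using h) h1 hw
  exact ⟨z₁, rfl, rfl⟩

theorem split_append_right {a : A} {w z : List A} (h : u ++ v = w ++ a :: z) (hw : a ∉ w)
    (ha : a ∉ u) : ∃ w₁, v = w₁ ++ a :: z ∧ w = u ++ w₁ ∧ a ∉ w₁ := by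
  have hv : a ∈ v := by
    have : a ∈ u ++ v := by rw [h]; simp
    simpa [ha] using this
  obtain ⟨w₁, z₁, rfl, h1⟩ := exists_split hv
  obtain ⟨rfl, rfl⟩ := split_unique (w := u ++ w₁) (by simpa using h) (by simp [ha, h1]) hw
  exact ⟨w₁, rfl, rfl, h1⟩

theorem refl (n m : ℕ) (u : List A) : LEqv n m u u := by
  induction n generalizing m u with
  | zero => trivial
  | succ n ih =>
    cases m with
    | zero => trivial
    | succ m =>
      refine ⟨fun _ => Iff.rfl, ih _ _, ?_⟩
      rintro a w z w' z' rfl hw h hw'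
      obtain ⟨rfl, rfl⟩ := split_unique h hw hw'
      exact ⟨ih _ _, ih _ _⟩

theorem symm (h : LEqv n m u v) : LEqv n m v u := by
  induction n generalizing m u v with
  | zero => trivial
  | succ n ih =>
    cases m with
    | zero => trivial
    | succ m =>
      obtain ⟨h1, h2, h3⟩ := h
      refine ⟨fun a => (h1 a).symm, ih h2, ?_⟩
      intro a w z w' z' e hw e' hw'
      obtain ⟨h4, h5⟩ := h3 a w' z' w z e' hw' e hw
      exact ⟨ih h4, ih h5⟩

theorem trans {x : List A} (h : LEqv n m u v) (h' : LEqv n m v x) : LEqv n m u x := by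
  induction n generalizing m u v x with
  | zero => trivial
  | succ n ih =>
    cases m with
    | zero => trivial
    | succ m =>
      obtain ⟨h1, h2, h3⟩ := h
      obtain ⟨h1', h2', h3'⟩ := h'
      refine ⟨fun a => (h1 a).trans (h1' a), ih h2 h2', ?_⟩
      intro a w z w' z' e hw e' hw'
      obtain ⟨w₁, z₁, e₁, hw₁⟩ := exists_split ((h1 a).1 (by rw [e]; simp))
      obtain ⟨h4, h5⟩ := h3 a w z w₁ z₁ e hw e₁ hw₁
      obtain ⟨h4', h5'⟩ := h3' a w₁ z₁ w' z' e₁ hw₁ e' hw'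
      exact ⟨ih h4 h4', ih h5 h5'⟩

theorem of_succ (h : LEqv (n + 1) m u v) : LEqv n m u v := by
  induction n generalizing m u v with
  | zero => trivial
  | succ n ih =>
    cases m with
    | zero => trivial
    | succ m =>
      obtain ⟨h1, h2, h3⟩ := h
      refine ⟨h1, ih h2, ?_⟩
      intro a w z w' z' e hw e' hw'
      obtain ⟨h4, h5⟩ := h3 a w z w' z' e hw e' hw'
      exact ⟨ih h4, ih h5⟩

theorem mono {k : ℕ} (hk : n ≤ k) (h : LEqv k m u v) : LEqv n m u v := by
  induction hk with
  | refl => exact h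
  | step _ ih => exact ih h.of_succ

theorem append (h : LEqv n m u v) (h' : LEqv n m u' v') :
    LEqv n m (u ++ u') (v ++ v') := by
  induction n generalizing m u v u' v' with
  | zero => trivial
  | succ n ih =>
    cases m with
    | zero => trivial
    | succ m =>
      have h0' := h'.of_succ
      obtain ⟨h1, h2, h3⟩ := h
      obtain ⟨h1', h2', h3'⟩ := h'
      refine ⟨fun a => by simp [h1, h1'], by simpa using ih h2' h2, ?_⟩
      intro a w z w' z' e hw e' hw'
      by_cases ha : a ∈ u
      · obtain ⟨z₁, e₁, rfl⟩ := split_append_left e hw ha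
        obtain ⟨z₁', e₁', rfl⟩ := split_append_left e' hw' ((h1 a).1 ha)
        obtain ⟨h4, h5⟩ := h3 a w z₁ w' z₁' e₁ hw e₁' hw'
        exact ⟨h4, ih h5 h0'⟩
      · obtain ⟨w₁, e₁, rfl, hw₁⟩ := split_append_right e hw ha
        obtain ⟨w₁', e₁', rfl, hw₁'⟩ := split_append_right e' hw' (mt (h1 a).2 ha)
        obtain ⟨h4, h5⟩ := h3' a w₁ z w₁' z' e₁ hw₁ e₁' hw₁'
        exact ⟨by simpa using ih h4 h2, h5⟩

theorem mem_iff (h : LEqv (n + 1) (m + 1) u v) (a : A) : a ∈ u ↔ a ∈ v := h.1 a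

theorem reverse_of_succ (h : LEqv (n + 1) (m + 1) u v) : LEqv n m u.reverse v.reverse := h.2.1

/-- For `m ≥ 2` the factor before a first occurrence is preserved by `≡_m^X` itself. -/
theorem left_factor {a : A} {w z w' z' : List A}
    (h : LEqv (n + 1) (m + 2) (w ++ a :: z) (w' ++ a :: z')) (hw : a ∉ w) (hw' : a ∉ w') :
    LEqv n (m + 2) w w' := by
  induction n generalizing w w' with
  | zero => trivial
  | succ n ih =>
    obtain ⟨-, -, h3⟩ := h
    obtain ⟨h4, -⟩ := h3 a w z w' z' rfl hw rfl hw'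
    refine ⟨fun b => by simpa using h4.1 b, h4.of_succ, ?_⟩
    rintro b x y x' y' rfl hx rfl hx'
    obtain ⟨h5, h6⟩ := h3 b x (y ++ a :: z) x' (y' ++ a :: z') (by simp) hx (by simp) hx'
    simp only [List.mem_append, List.mem_cons, not_or] at hw hw'
    exact ⟨h5.of_succ, ih h6 hw.2.2 hw'.2.2⟩

end LEqv

section Powers

variable {A : Type}

theorem listNPow_add (l : List A) (i j : ℕ) :
    listNPow l (i + j) = listNPow l i ++ listNPow l j := by
  induction i with
  | zero => simp [listNPow]
  | succ i ih => rw [Nat.succ_add, listNPow, ih, listNPow, List.append_assoc]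

theorem listNPow_succ' (l : List A) (k : ℕ) : listNPow l (k + 1) = listNPow l k ++ l := by
  rw [listNPow_add, listNPow, listNPow, List.append_nil]

theorem reverse_listNPow (l : List A) (k : ℕ) :
    (listNPow l k).reverse = listNPow l.reverse k := by
  induction k with
  | zero => rfl
  | succ k ih => rw [listNPow, listNPow_succ', List.reverse_append, ih]

theorem mem_listNPow {l : List A} {k : ℕ} {a : A} (h : a ∈ listNPow l k) : a ∈ l := by
  induction k with
  | zero => simp [listNPow] at h
  | succ k ih => simp only [listNPow, List.mem_append] at h; exact h.elim id ih

theorem LEqv.listNPow {n m : ℕ} {u v : List A} (h : LEqv n m u v) (k : ℕ) :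
    LEqv n m (listNPow u k) (listNPow v k) := by
  induction k with
  | zero => exact LEqv.refl _ _ _
  | succ k ih => exact h.append ih

/-- After `k` blocks using all letters, `≡_{m+1,k}^X` only sees the remainder
up to `≡_{m,k}^Y`. -/
theorem LEqv.absorb {k m : ℕ} {x x' y y' r r' : List A} (hx : LEqv k (m + 1) x x')
    (hy : LEqv k (m + 1) y y') (hr : LEqv k m r.reverse r'.reverse)
    (hry : ∀ a ∈ r, a ∈ y) (hry' : ∀ a ∈ r', a ∈ y') :
    LEqv k (m + 1) (x ++ (_root_.listNPow y k ++ r)) (x' ++ (_root_.listNPow y' k ++ r')) := by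
  induction k generalizing x x' r r' with
  | zero => trivial
  | succ k ih =>
    have hyr : LEqv (k + 1) (m + 1) y y' := hy
    obtain ⟨x1, x2, x3⟩ := hx
    obtain ⟨y1, y2, y3⟩ := hy
    refine ⟨fun a => ?_, ?_, ?_⟩
    · have e1 : a ∈ _root_.listNPow y (k + 1) ++ r ↔ a ∈ y := by
        simp only [_root_.listNPow, List.mem_append]
        exact ⟨fun h => h.elim (fun h => h.elim id mem_listNPow) (hry a), fun h => .inl (.inl h)⟩
      have e2 : a ∈ _root_.listNPow y' (k + 1) ++ r' ↔ a ∈ y' := by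
        simp only [_root_.listNPow, List.mem_append]
        exact ⟨fun h => h.elim (fun h => h.elim id mem_listNPow) (hry' a), fun h => .inl (.inl h)⟩
      rw [List.mem_append, e1, x1, y1, ← e2, ← List.mem_append]
    · simp only [List.reverse_append, reverse_listNPow]
      exact (hr.of_succ.append (y2.listNPow _)).append x2
    · intro a w z w' z' e hw e' hw'
      by_cases ha : a ∈ x
      · obtain ⟨z₁, e₁, rfl⟩ := split_append_left e hw ha
        obtain ⟨z₁', e₁', rfl⟩ := split_append_left e' hw' ((x1 a).1 ha)
        obtain ⟨h4, h5⟩ := x3 a w z₁ w' z₁' e₁ hw e₁' hw'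
        refine ⟨h4, ?_⟩
        rw [listNPow_succ', listNPow_succ', List.append_assoc, List.append_assoc]
        refine ih (r := y ++ r) (r' := y' ++ r') h5 hyr.of_succ ?_ ?_ ?_
        · simpa using hr.of_succ.append y2
        · exact fun b hb => (List.mem_append.1 hb).elim id (hry b)
        · exact fun b hb => (List.mem_append.1 hb).elim id (hry' b)
      · have ha' : a ∉ x' := mt (x1 a).2 ha
        obtain ⟨w₁, e₁, rfl, hw₁⟩ := split_append_right e hw ha
        obtain ⟨w₁', e₁', rfl, hw₁'⟩ := split_append_right e' hw' ha'
        have hay : a ∈ y := by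
          have : a ∈ _root_.listNPow y (k + 1) ++ r := by rw [e₁]; simp
          rcases List.mem_append.1 this with h | h
          · exact mem_listNPow h
          · exact hry a h
        rw [_root_.listNPow, List.append_assoc] at e₁ e₁'
        obtain ⟨z₁, e₂, rfl⟩ := split_append_left e₁ hw₁ hay
        obtain ⟨z₁', e₂', rfl⟩ := split_append_left e₁' hw₁' ((y1 a).1 hay)
        obtain ⟨h4, h5⟩ := y3 a w₁ z₁ w₁' z₁' e₂ hw₁ e₂' hw₁'
        refine ⟨by simpa using h4.append x2, ?_⟩
        exact ih h5 hyr.of_succ hr.of_succ hry hry'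

end Powers

/-! ## Finite index -/

theorem LEqv.exists_finite_invariant {A : Type} [Finite A] (n m : ℕ) :
    ∃ (T : Type) (_ : Finite T) (f : List A → T), ∀ u v, f u = f v → LEqv n m u v := by
  induction n generalizing m with
  | zero => exact ⟨Unit, inferInstance, fun _ => (), fun _ _ _ => trivial⟩
  | succ n ih =>
    cases m with
    | zero => exact ⟨Unit, inferInstance, fun _ => (), fun _ _ _ => trivial⟩
    | succ m =>
      obtain ⟨T₁, _, f₁, h₁⟩ := ih m
      obtain ⟨T₂, _, f₂, h₂⟩ := ih (m + 1)
      refine ⟨Set A × T₁ × (A → Option (T₁ × T₂)), inferInstance, fun u =>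
        ({a | a ∈ u}, f₁ u.reverse, fun a =>
          if h : ∃ p : List A × List A, u = p.1 ++ a :: p.2 ∧ a ∉ p.1 then
            some (f₁ h.choose.1.reverse, f₂ h.choose.2) else none), ?_⟩
      intro u v huv
      simp only [Prod.mk.injEq] at huv
      obtain ⟨e1, e2, e3⟩ := huv
      refine ⟨fun a => Set.ext_iff.1 e1 a, h₁ _ _ e2, ?_⟩
      intro a w z w' z' e hw e' hw'
      have hu : ∃ p : List A × List A, u = p.1 ++ a :: p.2 ∧ a ∉ p.1 := ⟨(w, z), e, hw⟩
      have hv : ∃ p : List A × List A, v = p.1 ++ a :: p.2 ∧ a ∉ p.1 := ⟨(w', z'), e', hw'⟩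
      have h3 := congrFun e3 a
      rw [dif_pos hu, dif_pos hv] at h3
      obtain ⟨c1, c2⟩ := split_unique (hu.choose_spec.1.symm.trans e) hu.choose_spec.2 hw
      obtain ⟨d1, d2⟩ := split_unique (hv.choose_spec.1.symm.trans e') hv.choose_spec.2 hw'
      rw [c1, c2, d1, d2] at h3
      simp only [Option.some.injEq, Prod.mk.injEq] at h3
      exact ⟨h₁ _ _ h3.1, h₂ _ _ h3.2⟩

/-- `≡_{m,n}^X` as a congruence on the free monoid. -/
def LEqv.con (A : Type) (n m : ℕ) : Con (FreeMonoid A) where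
  r u v := LEqv n m u.toList v.toList
  iseqv := ⟨fun _ => LEqv.refl _ _ _, LEqv.symm, LEqv.trans⟩
  mul' h h' := by simpa using LEqv.append h h'

instance {A : Type} [Finite A] (n m : ℕ) : Finite (LEqv.con A n m).Quotient := by
  obtain ⟨T, _, f, hf⟩ := LEqv.exists_finite_invariant (A := A) n m
  refine Finite.of_injective
    (fun q : (LEqv.con A n m).Quotient => f (Quotient.out q : FreeMonoid A).toList) ?_
  intro p q h
  rw [← Quotient.out_eq p, ← Quotient.out_eq q]
  exact Quotient.sound (hf _ _ h)

/-! ## Subwords and `J`-trivial monoids (Simon's theorem) -/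

section Subwords

variable {A : Type}

theorem cons_sublist_split_iff {a : A} {w z x : List A} (hw : a ∉ w) :
    (a :: x).Sublist (w ++ a :: z) ↔ x.Sublist z := by
  induction w with
  | nil => simp
  | cons b w ih =>
    simp only [List.mem_cons, not_or] at hw
    rw [← ih hw.2, List.cons_append]
    refine ⟨fun h => ?_, fun h => h.cons _⟩
    cases h with
    | cons _ h => exact h
    | cons_cons _ _ => exact absurd rfl hw.1

theorem LEqv.sublist {n : ℕ} {u v x : List A} (h : LEqv n 1 u v) (hx : x.length ≤ n)
    (hxu : x.Sublist u) : x.Sublist v := by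
  induction n generalizing u v x with
  | zero => simp [List.length_eq_zero_iff.1 (Nat.le_zero.1 hx)]
  | succ n ih =>
    cases x with
    | nil => simp
    | cons a x =>
      have hau : a ∈ u := hxu.subset (by simp)
      obtain ⟨w, z, rfl, hw⟩ := LEqv.exists_split hau
      obtain ⟨w', z', rfl, hw'⟩ := LEqv.exists_split ((h.mem_iff a).1 hau)
      rw [cons_sublist_split_iff hw] at hxu
      rw [cons_sublist_split_iff hw']
      exact ih (h.2.2 a w z w' z' rfl hw rfl hw').2 (by simpa using hx) hxu

theorem LEqv.of_sublist {n : ℕ} {u v : List A}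
    (h : ∀ x : List A, x.length ≤ n → (x.Sublist u ↔ x.Sublist v)) : LEqv n 1 u v := by
  induction n generalizing u v with
  | zero => trivial
  | succ n ih =>
    refine ⟨fun a => by simpa using h [a] (by simp), zero_right _ _ _, ?_⟩
    rintro a w z w' z' rfl hw rfl hw'
    refine ⟨zero_right _ _ _, ih fun x hx => ?_⟩
    exact ((cons_sublist_split_iff hw).symm.trans
      (h (a :: x) (by simpa using hx))).trans (cons_sublist_split_iff hw')

/-- The subword of `u` on the positions of the leftmost embedding of `a` and of the rightmost
embedding of `b`. -/
noncomputable def mergeEmb : List A → List A → List A → List A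
  | [], _, _ => []
  | x :: u, a, b =>
    if a.head? = some x ∨ ¬ b.Sublist u then
      x :: mergeEmb u (if a.head? = some x then a.tail else a)
        (if b.Sublist u then b else b.tail)
    else mergeEmb u a b

theorem mergeEmb_nil_left {u b : List A} (h : b.Sublist u) : mergeEmb u [] b = b := by
  induction u generalizing b with
  | nil => rw [List.sublist_nil.1 h]; rfl
  | cons x u ih =>
    by_cases hb : b.Sublist u
    · simp [mergeEmb, hb, ih]
    · cases h with
      | cons _ h => exact absurd h hb
      | cons_cons _ h => simp [mergeEmb, hb, ih h]

theorem mergeEmb_nil_right {u a : List A} (h : a.Sublist u) : mergeEmb u a [] = a := by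
  induction u generalizing a with
  | nil => rw [List.sublist_nil.1 h]; rfl
  | cons x u ih =>
    by_cases hb : a.head? = some x
    · cases a with
      | nil => simp at hb
      | cons y a =>
        obtain rfl : y = x := by simpa using hb
        simp [mergeEmb, ih (List.cons_sublist_cons.1 h)]
    · cases h with
      | cons _ h => simp [mergeEmb, hb, ih h]
      | cons_cons _ h => simp at hb

theorem mergeEmb_cons_of_sublist {x : A} {w z a b : List A} (hw : x ∉ w) (hb : b.Sublist z) :
    mergeEmb (w ++ x :: z) (x :: a) b = x :: mergeEmb z a b := by
  induction w with
  | nil => simp [mergeEmb, hb]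
  | cons y w ih =>
    simp only [List.mem_cons, not_or] at hw
    have : b.Sublist (w ++ x :: z) := (hb.cons x).trans (List.sublist_append_right _ _)
    simp [mergeEmb, hw.1, this, ih hw.2]

theorem mergeEmb_cons_cons {x : A} {w z a b : List A} (hw : x ∉ w) (hb : b.Sublist z)
    (hb' : ¬ (x :: b).Sublist z) :
    mergeEmb (w ++ x :: z) (x :: a) (x :: b) = x :: mergeEmb z a b := by
  induction w with
  | nil => simp [mergeEmb, hb']
  | cons y w ih =>
    simp only [List.mem_cons, not_or] at hw
    have : (x :: b).Sublist (w ++ x :: z) := (cons_sublist_split_iff hw.2).2 hb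
    simp [mergeEmb, hw.1, this, ih hw.2]

theorem mergeEmb_cons_of_ne {x y : A} {w z a b : List A} (hw : x ∉ w) (hxy : x ≠ y)
    (hb : (y :: b).Sublist (w ++ x :: z)) (hb' : ¬ (y :: b).Sublist z) :
    mergeEmb (w ++ x :: z) (x :: a) (y :: b) = y :: mergeEmb (w ++ x :: z) (x :: a) b := by
  induction w with
  | nil =>
    cases hb with
    | cons _ h => exact absurd h hb'
    | cons_cons _ _ => exact absurd rfl hxy
  | cons c w ih =>
    simp only [List.mem_cons, not_or] at hw
    by_cases h : (y :: b).Sublist (w ++ x :: z)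
    · have h' : b.Sublist (w ++ x :: z) := (List.sublist_cons_self _ _).trans h
      simp [mergeEmb, hw.1, h, h', ih hw.2 h]
    · cases hb with
      | cons _ h' => exact absurd h' h
      | cons_cons _ h' =>
        rw [List.append_eq] at h'
        simp [mergeEmb, hw.1, h, h']

theorem LEqv.mergeEmb_eq {n : ℕ} {u v a b : List A} (h : LEqv n 1 u v)
    (hn : a.length + b.length ≤ n) (ha : a.Sublist u) (hb : b.Sublist u) :
    mergeEmb u a b = mergeEmb v a b := by
  induction n generalizing u v a b with
  | zero =>
    obtain rfl := List.length_eq_zero_iff.1 (show a.length = 0 by omega)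
    obtain rfl := List.length_eq_zero_iff.1 (show b.length = 0 by omega)
    rw [mergeEmb_nil_left (by simp), mergeEmb_nil_left (by simp)]
  | succ n ih =>
    have ha' := h.sublist (by omega) ha
    have hb' := h.sublist (by omega) hb
    cases a with
    | nil => rw [mergeEmb_nil_left hb, mergeEmb_nil_left hb']
    | cons x a =>
      cases b with
      | nil => rw [mergeEmb_nil_right ha, mergeEmb_nil_right ha']
      | cons y b =>
        obtain ⟨w, z, rfl, hw⟩ := LEqv.exists_split (ha.subset (List.mem_cons_self ..))
        obtain ⟨w', z', rfl, hw'⟩ := LEqv.exists_split (ha'.subset (List.mem_cons_self ..))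
        have hz := (h.2.2 x w z w' z' rfl hw rfl hw').2
        simp only [List.length_cons] at hn
        by_cases hbz : (y :: b).Sublist z
        · have hbz' := hz.sublist (by simp; omega) hbz
          rw [mergeEmb_cons_of_sublist hw hbz, mergeEmb_cons_of_sublist hw' hbz',
            ih hz (by simp; omega) ((cons_sublist_split_iff hw).1 ha) hbz]
        · have hbz' : ¬ (y :: b).Sublist z' :=
            fun h' => hbz (hz.symm.sublist (by simp; omega) h')
          by_cases hxy : x = y
          · subst hxy
            have h1 := (cons_sublist_split_iff hw).1 hb
            have h2 := (cons_sublist_split_iff hw').1 hb'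
            rw [mergeEmb_cons_cons hw h1 hbz, mergeEmb_cons_cons hw' h2 hbz',
              ih hz (by omega) ((cons_sublist_split_iff hw).1 ha) h1]
          · rw [mergeEmb_cons_of_ne hw hxy hb hbz, mergeEmb_cons_of_ne hw' hxy hb' hbz',
              ih h.of_succ (by simp; omega) ha ((List.sublist_cons_self _ _).trans hb)]

end Subwords

section Simon

variable {A M : Type} [Monoid M]

/-- The value of a word under a letter assignment. -/
def wordVal (f : A → M) (u : List A) : M := (u.map f).prod

@[simp] theorem wordVal_nil (f : A → M) : wordVal f [] = 1 := rfl

@[simp] theorem wordVal_cons (f : A → M) (a : A) (u : List A) :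
    wordVal f (a :: u) = f a * wordVal f u := by simp [wordVal]

@[simp] theorem wordVal_append (f : A → M) (u v : List A) :
    wordVal f (u ++ v) = wordVal f u * wordVal f v := by simp [wordVal]

theorem wordVal_listNPow (f : A → M) (u : List A) (k : ℕ) :
    wordVal f (listNPow u k) = wordVal f u ^ k := by
  induction k with
  | zero => simp [listNPow]
  | succ k ih => rw [listNPow, wordVal_append, ih, pow_succ']

theorem freeMonoidHom_apply (φ : FreeMonoid A →* M) (u : List A) :
    φ (FreeMonoid.ofList u) = wordVal (fun a => φ (FreeMonoid.of a)) u := by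
  induction u with
  | nil => simp
  | cons a u ih => rw [FreeMonoid.ofList_cons, map_mul, ih, wordVal_cons]

/-- The letters of `u` at which the product of `p` with a prefix of `u` changes. -/
noncomputable def rightJumps (f : A → M) : M → List A → List A
  | _, [] => []
  | p, x :: u => if p * f x = p then rightJumps f p u else x :: rightJumps f (p * f x) u

/-- The letters of `u` at which the product of a suffix of `u` with `q` changes. -/
noncomputable def leftJumps (f : A → M) (q : M) : List A → List A
  | [] => []
  | x :: u =>
    if f x * (wordVal f u * q) = wordVal f u * q then leftJumps f q u else x :: leftJumps f q u

theorem rightJumps_sublist (f : A → M) (p : M) (u : List A) : (rightJumps f p u).Sublist u := by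
  induction u generalizing p with
  | nil => simp [rightJumps]
  | cons x u ih =>
    rw [rightJumps]
    split_ifs
    · exact (ih _).cons _
    · exact (ih _).cons_cons _

theorem leftJumps_sublist (f : A → M) (q : M) (u : List A) : (leftJumps f q u).Sublist u := by
  induction u with
  | nil => simp [leftJumps]
  | cons x u ih =>
    rw [leftJumps]
    split_ifs
    · exact ih.cons _
    · exact ih.cons_cons _

theorem rightJumps_head (f : A → M) (p : M) (u : List A) (x : A)
    (h : (rightJumps f p u).head? = some x) : p * f x ≠ p := by
  induction u with
  | nil => simp [rightJumps] at h
  | cons y u ih =>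
    rw [rightJumps] at h
    split_ifs at h with h1
    · exact ih h
    · obtain rfl : y = x := by simpa using h
      exact h1

theorem leftJumps_rightmost (f : A → M) (q : M) (u : List A) (x : A)
    (h : (x :: leftJumps f q u).Sublist u) :
    f x * (wordVal f u * q) = wordVal f u * q := by
  induction u generalizing x with
  | nil => simp at h
  | cons y u ih =>
    rw [leftJumps] at h
    split_ifs at h with h1
    · rw [wordVal_cons, mul_assoc, h1]
      cases h with
      | cons _ h => exact ih _ h
      | cons_cons _ h => exact h1
    · exfalso
      apply h1
      cases h with
      | cons _ h => exact ih _ ((List.sublist_cons_self _ _).trans h)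
      | cons_cons _ h => exact ih _ h

theorem mul_wordVal_mergeEmb (f : A → M) (p : M) (u b : List A) :
    p * wordVal f (mergeEmb u (rightJumps f p u) b) = p * wordVal f u := by
  induction u generalizing p b with
  | nil => simp [mergeEmb]
  | cons x u ih =>
    by_cases hx : p * f x = p
    · have hh : (rightJumps f p u).head? ≠ some x := fun h => rightJumps_head f p u x h hx
      rw [rightJumps, if_pos hx, mergeEmb, wordVal_cons, ← mul_assoc, hx]
      by_cases hb : b.Sublist u
      · simp [hh, hb, ih]
      · simp only [hh, hb, false_or, not_false_eq_true, if_true, if_false, wordVal_cons]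
        rw [← mul_assoc, hx, ih]
    · rw [rightJumps, if_neg hx, mergeEmb]
      simp only [List.head?_cons, true_or, if_true, List.tail_cons, wordVal_cons]
      rw [← mul_assoc, ih, mul_assoc]

theorem wordVal_mergeEmb_mul (f : A → M) (q : M) (u a : List A) :
    wordVal f (mergeEmb u a (leftJumps f q u)) * q = wordVal f u * q := by
  induction u generalizing a with
  | nil => simp [mergeEmb]
  | cons x u ih =>
    by_cases hx : f x * (wordVal f u * q) = wordVal f u * q
    · rw [leftJumps, if_pos hx, mergeEmb]
      simp only [leftJumps_sublist, not_true_eq_false, or_false, if_true]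
      split_ifs with h
      · rw [wordVal_cons, mul_assoc, ih, wordVal_cons, mul_assoc]
      · rw [ih, wordVal_cons, mul_assoc, hx]
    · have hs : ¬ (x :: leftJumps f q u).Sublist u := fun h => hx (leftJumps_rightmost f q u x h)
      rw [leftJumps, if_neg hx, mergeEmb]
      simp only [hs, not_false_eq_true, or_true, if_true, if_false, List.tail_cons, wordVal_cons]
      rw [mul_assoc, ih, mul_assoc]

theorem IsJTrivial.eq_of_mul_right (h : IsJTrivial M) {p x : M} (hx : ∃ y, p * x * y = p) :
    p * x = p := by
  obtain ⟨y, hy⟩ := hx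
  refine h _ _ (Set.ext fun z => ⟨?_, ?_⟩)
  · rintro ⟨a, b, rfl⟩
    exact ⟨a, x * b, by simp only [mul_assoc]⟩
  · rintro ⟨a, b, rfl⟩
    exact ⟨a, y * b, by
      rw [mul_assoc a (p * x), ← mul_assoc (p * x), hy, mul_assoc]⟩

theorem IsJTrivial.eq_of_mul_left (h : IsJTrivial M) {p x : M} (hx : ∃ y, y * (x * p) = p) :
    x * p = p := by
  obtain ⟨y, hy⟩ := hx
  refine h _ _ (Set.ext fun z => ⟨?_, ?_⟩)
  · rintro ⟨a, b, rfl⟩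
    exact ⟨a * x, b, by simp only [mul_assoc]⟩
  · rintro ⟨a, b, rfl⟩
    exact ⟨a * y, b, by simp only [mul_assoc]; rw [← mul_assoc x p b, ← mul_assoc y, hy]⟩

/-- The size of the principal right ideal of `p`. -/
noncomputable def rightIdealCard (p : M) : ℕ := (Set.range (fun z => p * z)).ncard

/-- The size of the principal left ideal of `p`. -/
noncomputable def leftIdealCard (p : M) : ℕ := (Set.range (fun z => z * p)).ncard

theorem rightIdealCard_lt [Finite M] {p x : M} (h : ¬ ∃ y, p * x * y = p) :
    rightIdealCard (p * x) < rightIdealCard p := by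
  refine Set.ncard_lt_ncard ⟨?_, fun hs => ?_⟩ (Set.toFinite _)
  · rintro _ ⟨z, rfl⟩
    exact ⟨x * z, by simp [mul_assoc]⟩
  · obtain ⟨z, hz⟩ := hs ⟨1, mul_one p⟩
    exact h ⟨z, by simpa using hz⟩

theorem leftIdealCard_lt [Finite M] {p x : M} (h : ¬ ∃ y, y * (x * p) = p) :
    leftIdealCard (x * p) < leftIdealCard p := by
  refine Set.ncard_lt_ncard ⟨?_, fun hs => ?_⟩ (Set.toFinite _)
  · rintro _ ⟨z, rfl⟩
    exact ⟨z * x, by simp [mul_assoc]⟩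
  · obtain ⟨z, hz⟩ := hs ⟨1, one_mul p⟩
    exact h ⟨z, by simpa using hz⟩

theorem rightJumps_length_le [Finite M] (hM : IsJTrivial M) (f : A → M) (p : M) (u : List A) :
    (rightJumps f p u).length ≤ rightIdealCard p := by
  induction u generalizing p with
  | nil => simp [rightJumps]
  | cons x u ih =>
    rw [rightJumps]
    split_ifs with h
    · exact ih p
    · have := ih (p * f x)
      have := rightIdealCard_lt (p := p) (x := f x) fun h' => h (hM.eq_of_mul_right h')
      rw [List.length_cons]
      omega

theorem leftJumps_length_add_le [Finite M] (hM : IsJTrivial M) (f : A → M) (q : M)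
    (u : List A) :
    (leftJumps f q u).length + leftIdealCard (wordVal f u * q) ≤ leftIdealCard q := by
  induction u with
  | nil => simp [leftJumps]
  | cons x u ih =>
    rw [leftJumps, wordVal_cons, mul_assoc]
    split_ifs with h
    · rwa [h]
    · have := leftIdealCard_lt (p := wordVal f u * q) (x := f x)
        fun h' => h (hM.eq_of_mul_left h')
      rw [List.length_cons]
      omega

/-- Simon's theorem: a finite `J`-trivial monoid only sees subwords of bounded length. -/
theorem IsJTrivial.exists_LEqv [Finite M] (hM : IsJTrivial M) (f : A → M) :
    ∃ n, ∀ u v : List A, LEqv n 1 u v → wordVal f u = wordVal f v := by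
  refine ⟨rightIdealCard (1 : M) + leftIdealCard (1 : M), fun u v h => ?_⟩
  have ha := rightJumps_length_le hM f 1 u
  have hb := leftJumps_length_add_le hM f 1 v
  have hsu := h.symm.sublist (by omega) (leftJumps_sublist f 1 v)
  have e := h.mergeEmb_eq (by omega) (rightJumps_sublist f 1 u) hsu
  have e1 := mul_wordVal_mergeEmb f 1 u (leftJumps f 1 v)
  have e2 := wordVal_mergeEmb_mul f 1 v (rightJumps f 1 u)
  rw [one_mul, one_mul] at e1
  rw [mul_one, mul_one] at e2
  rw [← e1, ← e2, e]

end Simon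

/-! ## Finite monoids and the Trotter-Weil hierarchy -/

section Green

instance {M : Type} [Finite M] : Finite Mᵐᵒᵖ := Finite.of_equiv M MulOpposite.opEquiv

variable {A M : Type} [Monoid M]

theorem rGreen_iff {x y : M} : rGreen x y ↔ (∃ t, x * t = y) ∧ ∃ t, y * t = x := by
  constructor
  · intro h
    constructor
    · have : y ∈ Set.range (fun z => x * z) := by rw [h]; exact ⟨1, mul_one y⟩
      exact this
    · have : x ∈ Set.range (fun z => y * z) := by rw [← h]; exact ⟨1, mul_one x⟩
      exact this
  · rintro ⟨⟨t, rfl⟩, ⟨t', h⟩⟩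
    refine Set.ext fun z => ⟨?_, ?_⟩
    · rintro ⟨s, rfl⟩
      exact ⟨t' * s, by simp only [← mul_assoc, h]⟩
    · rintro ⟨s, rfl⟩
      exact ⟨t * s, by simp only [mul_assoc]⟩

theorem rGreen_mul_left_iff {e x : M} : rGreen (e * x) e ↔ ∃ t, e * x * t = e := by
  rw [rGreen_iff]
  exact ⟨fun h => h.1, fun h => ⟨h, x, rfl⟩⟩

theorem rGreen_op_iff {x y : M} : rGreen (MulOpposite.op x) (MulOpposite.op y) ↔ lGreen x y := by
  unfold rGreen lGreen
  constructor
  · intro h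
    refine Set.ext fun z => ?_
    have := Set.ext_iff.1 h (MulOpposite.op z)
    simpa [MulOpposite.exists, ← MulOpposite.op_mul] using this
  · intro h
    refine Set.ext fun z => ?_
    have := Set.ext_iff.1 h z.unop
    induction z with | _ z => simpa [MulOpposite.exists, ← MulOpposite.op_mul] using this

theorem simK_op_iff {x y : M} : simK (MulOpposite.op x) (MulOpposite.op y) ↔ simD x y := by
  unfold simK simD
  rw [MulOpposite.forall]
  refine forall_congr' fun e => ?_
  simp only [IsIdempotentElem, ← MulOpposite.op_mul, rGreen_op_iff, MulOpposite.op_inj]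

theorem exists_idempotent_pow [Finite M] (x : M) : ∃ n, 1 ≤ n ∧ IsIdempotentElem (x ^ n) := by
  obtain ⟨i, j, hij, h⟩ := Finite.exists_ne_map_eq_of_infinite (fun n : ℕ => x ^ n)
  wlog hlt : i < j generalizing i j
  · exact this j i hij.symm h.symm (by omega)
  obtain ⟨d, rfl⟩ := Nat.exists_eq_add_of_lt hlt
  have hd : x ^ (i + (d + 1)) = x ^ i := h.symm
  have key : ∀ k l, i ≤ l → x ^ (l + k * (d + 1)) = x ^ l := by
    intro k l hl
    induction k with
    | zero => simp
    | succ k ih =>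
      obtain ⟨c, rfl⟩ := Nat.exists_eq_add_of_le hl
      rw [← ih, show i + c + (k + 1) * (d + 1) = (i + (d + 1)) + (c + k * (d + 1)) by ring,
        pow_add, hd, ← pow_add]
      congr 1
      ring
  refine ⟨(i + 1) * (d + 1), Nat.mul_pos (by omega) (by omega), ?_⟩
  rw [IsIdempotentElem, ← pow_add]
  exact key _ _ (by nlinarith)

theorem pow_eq_of_idempotent {x : M} {n : ℕ} (h : IsIdempotentElem (x ^ n)) {k : ℕ}
    (hk : 1 ≤ k) : x ^ (n * k) = x ^ n := by
  rw [pow_mul]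
  obtain ⟨k, rfl⟩ := Nat.exists_eq_add_of_le' hk
  exact h.pow_succ_eq k

theorem monoidExp_spec (M : Type) [Monoid M] [Finite M] :
    1 ≤ monoidExp M ∧ ∀ x : M, IsIdempotentElem (x ^ monoidExp M) := by
  have hne : {n : ℕ | 1 ≤ n ∧ ∀ x : M, IsIdempotentElem (x ^ n)}.Nonempty := by
    choose g hg1 hg using fun x : M => exists_idempotent_pow x
    have := Fintype.ofFinite M
    refine ⟨∏ x, g x, Nat.one_le_iff_ne_zero.2 (Finset.prod_ne_zero_iff.2 fun x _ => ?_),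
      fun x => ?_⟩
    · have := hg1 x; omega
    · obtain ⟨k, hk⟩ := Finset.dvd_prod_of_mem g (Finset.mem_univ x)
      rw [hk]
      rcases Nat.eq_zero_or_pos k with rfl | h
      · simp [IsIdempotentElem]
      · rw [pow_eq_of_idempotent (hg x) h]
        exact hg x
  exact Nat.sInf_mem hne

theorem mul_pow_eq_self {p x : M} (h : p * x = p) (n : ℕ) : p * x ^ n = p := by
  induction n with
  | zero => simp
  | succ n ih => rw [pow_succ, ← mul_assoc, ih, h]

theorem rGreen_pow_mul {x t : M} {n : ℕ} (hn : 1 ≤ n) (he : IsIdempotentElem ((x * t) ^ n)) :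
    rGreen ((x * t) ^ n * x) ((x * t) ^ n) := by
  rw [rGreen_mul_left_iff]
  obtain ⟨k, rfl⟩ := Nat.exists_eq_add_of_le' hn
  refine ⟨t * (x * t) ^ k, ?_⟩
  rw [mul_assoc, ← mul_assoc x, ← pow_succ', he.eq]

/-- If `p` is stabilized by `x * t`, then `p = p * e` for an idempotent `e` with `e * x R e`. -/
theorem exists_idempotent_of_stable [Finite M] {p x t : M} (h : p * (x * t) = p) :
    ∃ e : M, IsIdempotentElem e ∧ p * e = p ∧ rGreen (e * x) e := by
  obtain ⟨n, hn, he⟩ := exists_idempotent_pow (x * t)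
  exact ⟨(x * t) ^ n, he, mul_pow_eq_self h n, rGreen_pow_mul hn he⟩

theorem simK.mul_eq [Finite M] {x y p t : M} (h : simK x y) (hp : p * (x * t) = p) :
    p * x = p * y := by
  obtain ⟨e, he, hpe, hr⟩ := exists_idempotent_of_stable hp
  rw [← hpe, mul_assoc, h e he (.inl hr), ← mul_assoc]

theorem simK.symm {x y : M} (h : simK x y) : simK y x :=
  fun e he hr => (h e he hr.symm).symm

theorem simK.trans {x y z : M} (h : simK x y) (h' : simK y z) : simK x z := by
  intro e he hr
  rcases hr with hr | hr
  · have e1 := h e he (.inl hr)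
    rw [e1] at hr ⊢
    exact h' e he (.inl hr)
  · have e1 := h' e he (.inr hr)
    rw [← e1] at hr ⊢
    exact h e he (.inr hr)

theorem simK.mul_right {x y : M} (h : simK x y) (z : M) : simK (x * z) (y * z) := by
  intro e he hr
  simp only [rGreen_mul_left_iff] at hr
  rw [← mul_assoc, ← mul_assoc]
  congr 1
  refine h e he ?_
  simp only [rGreen_mul_left_iff]
  exact hr.imp (fun ⟨t, ht⟩ => ⟨z * t, by simpa only [mul_assoc] using ht⟩)
    (fun ⟨t, ht⟩ => ⟨z * t, by simpa only [mul_assoc] using ht⟩)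

theorem simK.mul_left [Finite M] {x y : M} (h : simK x y) (z : M) : simK (z * x) (z * y) := by
  have aux : ∀ {x y : M}, simK x y → ∀ e : M, rGreen (e * (z * x)) e →
      e * (z * x) = e * (z * y) := by
    intro x y h e hr
    obtain ⟨t, ht⟩ := rGreen_mul_left_iff.1 hr
    have : e * z * (x * (t * z)) = e * z := by
      conv_rhs => rw [← ht]
      simp only [mul_assoc]
    simpa only [mul_assoc] using h.mul_eq this
  intro e _ hr
  exact hr.elim (aux h e) fun hr => (aux h.symm e hr).symm

theorem simK_of_KCon [Finite M] {x y : M} (h : KCon M x y) : simK x y := by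
  let c : Con M :=
    { r := simK
      iseqv := ⟨fun _ _ _ _ => rfl, simK.symm, simK.trans⟩
      mul' := fun {w x y z} h h' => (h.mul_right y).trans (h'.mul_left x) }
  have : KCon M ≤ c := Con.conGen_le.2 fun x y h => h
  exact this h

theorem simK.map {N : Type} [Monoid N] [Finite M] (f : M →* N)
    (hf : Function.Surjective f) {x y : M} (h : simK x y) : simK (f x) (f y) := by
  have aux : ∀ {x y : M}, simK x y → ∀ e : N, rGreen (e * f x) e → e * f x = e * f y := by
    intro x y h e hr
    obtain ⟨t, ht⟩ := rGreen_mul_left_iff.1 hr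
    obtain ⟨t, rfl⟩ := hf t
    obtain ⟨n, hn, hg⟩ := exists_idempotent_pow (x * t)
    have h1 : e * f ((x * t) ^ n) = e := by
      rw [map_pow]
      exact mul_pow_eq_self (by rw [map_mul, ← mul_assoc, ht]) n
    rw [← h1, mul_assoc, mul_assoc, ← map_mul, ← map_mul, h _ hg (.inl (rGreen_pow_mul hn hg))]
  intro e _ hr
  exact hr.elim (aux h e) fun hr => (aux h.symm e hr).symm

theorem simD_of_DCon [Finite M] {x y : M} (h : DCon M x y) : simD x y := by
  let c : Con M :=
    { r := simD
      iseqv := ⟨fun _ _ _ _ => rfl, fun h => simK_op_iff.1 (simK_op_iff.2 h).symm,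
        fun h h' => simK_op_iff.1 ((simK_op_iff.2 h).trans (simK_op_iff.2 h'))⟩
      mul' := fun {w x y z} h h' => simK_op_iff.1 <| by
        rw [MulOpposite.op_mul, MulOpposite.op_mul]
        exact ((simK_op_iff.2 h').mul_right _).trans ((simK_op_iff.2 h).mul_left _) }
  have : DCon M ≤ c := Con.conGen_le.2 fun x y h => h
  exact this h

theorem simD.map {N : Type} [Monoid N] [Finite M] (f : M →* N)
    (hf : Function.Surjective f) {x y : M} (h : simD x y) : simD (f x) (f y) :=
  simK_op_iff.1 <| (simK_op_iff.2 h).map (MonoidHom.op f) fun z => by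
    obtain ⟨w, hw⟩ := hf z.unop
    exact ⟨MulOpposite.op w, by simp [hw]⟩

theorem IsJTrivial.of_surjective {N : Type} [Monoid N] [Finite M] (hM : IsJTrivial M)
    (f : M →* N) (hf : Function.Surjective f) : IsJTrivial N := by
  intro x y h
  obtain ⟨a, b, hx⟩ : x ∈ {z | ∃ a b, z = a * y * b} := h ▸ ⟨1, 1, by simp⟩
  obtain ⟨c, d, hy⟩ : y ∈ {z | ∃ a b, z = a * x * b} := h ▸ ⟨1, 1, by simp⟩
  obtain ⟨a, rfl⟩ := hf a
  obtain ⟨b, rfl⟩ := hf b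
  obtain ⟨c, rfl⟩ := hf c
  obtain ⟨d, rfl⟩ := hf d
  obtain ⟨hn, he⟩ := monoidExp_spec M
  obtain ⟨n, hn⟩ := Nat.exists_eq_add_of_le' hn
  rw [hn] at he
  have hxn : ∀ n, f ((a * c) ^ n) * x * f ((d * b) ^ n) = x := by
    intro n
    induction n with
    | zero => simp
    | succ n ih =>
      rw [pow_succ, pow_succ', f.map_mul _ (a * c), f.map_mul (d * b)]
      have : f (a * c) * x * f (d * b) = x := by
        conv_rhs => rw [hx, hy]
        simp only [map_mul, mul_assoc]
      rw [show ∀ p q r s : N, p * q * x * (r * s) = p * (q * x * r) * s by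
        intros; simp only [mul_assoc], this, ih]
  have h1 : c * (a * c) ^ (n + 1) = (a * c) ^ (n + 1) := hM.eq_of_mul_left
    ⟨(a * c) ^ n * a, by
      rw [← mul_assoc, mul_assoc _ a c, ← pow_succ, (he _).eq]⟩
  have h2 : (d * b) ^ (n + 1) * d = (d * b) ^ (n + 1) := hM.eq_of_mul_right
    ⟨b * (d * b) ^ n, by
      rw [mul_assoc, ← mul_assoc d, ← pow_succ', (he _).eq]⟩
  rw [hy]
  conv_rhs => rw [← hxn (n + 1)]
  rw [show f c * (f ((a * c) ^ (n + 1)) * x * f ((d * b) ^ (n + 1))) * f d =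
    f (c * (a * c) ^ (n + 1)) * x * f ((d * b) ^ (n + 1) * d) by simp only [map_mul, mul_assoc],
    h1, h2, hxn]

theorem IsJTrivial.op (hM : IsJTrivial M) : IsJTrivial Mᵐᵒᵖ := by
  intro x y h
  apply MulOpposite.unop_injective
  apply hM
  have aux : ∀ (x : Mᵐᵒᵖ) (z : M), (∃ a b, MulOpposite.op z = a * x * b) ↔
      ∃ a b, z = a * x.unop * b := fun x z =>
    ⟨fun ⟨a, b, h⟩ => ⟨b.unop, a.unop, by
      rw [← MulOpposite.unop_op z, h]; simp [mul_assoc]⟩,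
    fun ⟨a, b, h⟩ => ⟨.op b, .op a, by rw [h]; simp [mul_assoc]⟩⟩
  exact Set.ext fun z => (aux x z).symm.trans ((Set.ext_iff.1 h (.op z)).trans (aux y z))

theorem InRLAux.of_surjective {k : ℕ} {b : Bool} {M N : Type} [iM : Monoid M] [iN : Monoid N]
    [Finite M] (h : InRLAux k b M iM) (f : M →* N) (hf : Function.Surjective f) :
    InRLAux k b N iN := by
  induction k generalizing b M N with
  | zero => exact IsJTrivial.of_surjective h f hf
  | succ k ih =>
    cases b with
    | true =>
      have hle : KCon M ≤ Con.ker ((KCon N).mk'.comp f) := Con.conGen_le.2 fun x y hxy =>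
        (KCon N).eq.2 (ConGen.Rel.of _ _ (hxy.map f hf))
      have hfin : Finite (KCon M).Quotient := Quotient.finite _
      exact ih h (Con.lift _ _ hle)
        (Con.lift_surjective_of_surjective hle ((Con.mk'_surjective).comp hf))
    | false =>
      have hle : DCon M ≤ Con.ker ((DCon N).mk'.comp f) := Con.conGen_le.2 fun x y hxy =>
        (DCon N).eq.2 (ConGen.Rel.of _ _ (hxy.map f hf))
      have hfin : Finite (DCon M).Quotient := Quotient.finite _
      exact ih h (Con.lift _ _ hle)
        (Con.lift_surjective_of_surjective hle ((Con.mk'_surjective).comp hf))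

/-- An antihomomorphism onto `N`, viewed as a homomorphism from the opposite monoid. -/
def homOfAntihom {M N : Type} [Monoid M] [Monoid N] (f : M →* Nᵐᵒᵖ) : Mᵐᵒᵖ →* N :=
  (MulEquiv.opOp N).symm.toMonoidHom.comp (MonoidHom.op f)

theorem homOfAntihom_surjective {M N : Type} [Monoid M] [Monoid N] {f : M →* Nᵐᵒᵖ}
    (hf : Function.Surjective f) : Function.Surjective (homOfAntihom f) := by
  intro z
  obtain ⟨w, hw⟩ := hf (MulOpposite.op z)
  exact ⟨MulOpposite.op w, by simp [homOfAntihom, hw]⟩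

/-- The map `x ↦ op (mk (op x))` for a congruence on the opposite monoid. -/
def opMkOp {M : Type} [Monoid M] (c : Con Mᵐᵒᵖ) : M →* c.Quotientᵐᵒᵖ where
  toFun x := MulOpposite.op (c.mk' (MulOpposite.op x))
  map_one' := by simp
  map_mul' x y := by simp

theorem opMkOp_surjective {M : Type} [Monoid M] (c : Con Mᵐᵒᵖ) :
    Function.Surjective (opMkOp c) := by
  intro z
  obtain ⟨w, hw⟩ := c.mk'_surjective z.unop
  exact ⟨w.unop, congrArg MulOpposite.op hw⟩

theorem InRLAux.op {k : ℕ} {b : Bool} {M : Type} [iM : Monoid M] [Finite M]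
    (h : InRLAux k b M iM) : InRLAux k (!b) Mᵐᵒᵖ inferInstance := by
  induction k generalizing b M with
  | zero => exact IsJTrivial.op h
  | succ k ih =>
    cases b with
    | true =>
      have hle : KCon M ≤ Con.ker (opMkOp (DCon Mᵐᵒᵖ)) := Con.conGen_le.2 fun x y hxy =>
        congrArg MulOpposite.op <| (DCon _).eq.2 <| ConGen.Rel.of _ _ <| simK_op_iff.1 <|
          hxy.map (MulEquiv.opOp M).toMonoidHom (MulEquiv.opOp M).surjective
      have hfin : Finite (KCon M).Quotient := Quotient.finite _
      exact (ih (b := false) h).of_surjective (homOfAntihom (Con.lift _ _ hle))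
        (homOfAntihom_surjective
          (Con.lift_surjective_of_surjective hle (opMkOp_surjective _)))
    | false =>
      have hle : DCon M ≤ Con.ker (opMkOp (KCon Mᵐᵒᵖ)) := Con.conGen_le.2 fun x y hxy =>
        congrArg MulOpposite.op <| (KCon _).eq.2 <| ConGen.Rel.of _ _ <| simK_op_iff.2 hxy
      have hfin : Finite (DCon M).Quotient := Quotient.finite _
      exact (ih (b := true) h).of_surjective (homOfAntihom (Con.lift _ _ hle))
        (homOfAntihom_surjective
          (Con.lift_surjective_of_surjective hle (opMkOp_surjective _)))

theorem InRLAux.pow_mul_pow {k : ℕ} {b : Bool} {M : Type} [iM : Monoid M] [Finite M]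
    (h : InRLAux k b M iM) (x y z : M) {n : ℕ} (hn : 1 ≤ n)
    (he : IsIdempotentElem ((x * y * z) ^ n)) :
    (x * y * z) ^ n * y * (x * y * z) ^ n = (x * y * z) ^ n := by
  induction k generalizing b M with
  | zero =>
    have hM : IsJTrivial M := h
    obtain ⟨n, rfl⟩ := Nat.exists_eq_add_of_le' hn
    have key : (x * y * z) ^ (n + 1) * (x * y * z * (x * y * z) ^ n) =
        (x * y * z) ^ (n + 1) := by rw [← pow_succ', he.eq]
    have h1 : (x * y * z) ^ (n + 1) * x = (x * y * z) ^ (n + 1) := hM.eq_of_mul_right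
      ⟨y * z * (x * y * z) ^ n, by conv_rhs => rw [← key]
                                   simp only [mul_assoc]⟩
    have h2 : (x * y * z) ^ (n + 1) * (x * y) = (x * y * z) ^ (n + 1) := hM.eq_of_mul_right
      ⟨z * (x * y * z) ^ n, by conv_rhs => rw [← key]
                               simp only [mul_assoc]⟩
    rw [← mul_assoc, h1] at h2
    rw [h2, he.eq]
  | succ k ih =>
    set e := (x * y * z) ^ n
    cases b with
    | true =>
      have hfin : Finite (KCon M).Quotient := Quotient.finite _
      have := ih (iM := inferInstance) (M := (KCon M).Quotient) h ((KCon M).mk' x)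
        ((KCon M).mk' y) ((KCon M).mk' z) (by
          simp only [← map_mul, ← map_pow]
          exact he.map _)
      simp only [← map_mul, ← map_pow] at this
      have hs := simK_of_KCon ((KCon M).eq.1 this) e he (.inr (by rw [he.eq]; rfl))
      change e * (e * y * e) = e * e at hs
      rwa [← mul_assoc, ← mul_assoc, he.eq] at hs
    | false =>
      have hfin : Finite (DCon M).Quotient := Quotient.finite _
      have := ih (iM := inferInstance) (M := (DCon M).Quotient) h ((DCon M).mk' x)
        ((DCon M).mk' y) ((DCon M).mk' z) (by
          simp only [← map_mul, ← map_pow]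
          exact he.map _)
      simp only [← map_mul, ← map_pow] at this
      have hs := simD_of_DCon ((DCon M).eq.1 this) e he (.inr (by rw [he.eq]; rfl))
      change (e * y * e) * e = e * e at hs
      rwa [mul_assoc, he.eq] at hs

theorem wordVal_op (f : A → M) (u : List A) :
    wordVal (fun a => MulOpposite.op (f a)) u.reverse = MulOpposite.op (wordVal f u) := by
  induction u with
  | nil => simp
  | cons a u ih => simp [ih]

theorem map_wordVal {N : Type} [Monoid N] (g : M →* N) (f : A → M) (u : List A) :
    g (wordVal f u) = wordVal (fun a => g (f a)) u := by
  induction u with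
  | nil => simp
  | cons a u ih => simp [ih]

/-- In `DA`, appending a letter of `w` does not leave the `R`-class of `p * wordVal f w`. -/
theorem InRLAux.stable_of_mem {k : ℕ} {b : Bool} {M : Type} [iM : Monoid M] [Finite M]
    (h : InRLAux k b M iM) {f : A → M} {p t : M} {w : List A} (ht : p * wordVal f w * t = p)
    {a : A} (ha : a ∈ w) : ∃ t, p * wordVal f w * f a * t = p := by
  obtain ⟨v, s, rfl⟩ := List.append_of_mem ha
  set q := p * wordVal f (v ++ a :: s) with hq
  have hqs : q * (t * wordVal f v * f a * wordVal f s) = q := by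
    calc _ = q * t * wordVal f (v ++ a :: s) := by simp [mul_assoc]
      _ = q := by rw [ht]
  obtain ⟨n, hn, he⟩ := exists_idempotent_pow (t * wordVal f v * f a * wordVal f s)
  have hda := h.pow_mul_pow (t * wordVal f v) (f a) (wordVal f s) hn he
  have hqe := mul_pow_eq_self hqs n
  set e := (t * wordVal f v * f a * wordVal f s) ^ n
  refine ⟨e * t, ?_⟩
  calc q * f a * (e * t) = q * e * f a * (e * t) := by rw [hqe]
    _ = q * (e * f a * e) * t := by simp only [mul_assoc]
    _ = p := by rw [hda, hqe, ht]

theorem exists_first_drop {f : A → M} {p : M} {u : List A}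
    (h : ¬ ∃ t, p * wordVal f u * t = p) :
    ∃ w a z, u = w ++ a :: z ∧ (∃ t, p * wordVal f w * t = p) ∧
      ¬ ∃ t, p * wordVal f w * f a * t = p := by
  induction u using List.reverseRecOn with
  | nil => exact absurd ⟨1, by simp⟩ h
  | append_singleton u a ih =>
    by_cases hu : ∃ t, p * wordVal f u * t = p
    · exact ⟨u, a, [], rfl, hu, by simpa [mul_assoc] using h⟩
    · obtain ⟨w, b, z, rfl, h1, h2⟩ := ih hu
      exact ⟨w, b, z ++ [a], by simp, h1, h2⟩

/-- A finite monoid in `R_{k+1}` only sees words up to `≡_{k+1,n}^X`, for some `n`. -/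
theorem InRLAux.exists_LEqv {k : ℕ} {M : Type} [iM : Monoid M] [Finite M]
    (h : InRLAux k true M iM) (f : A → M) :
    ∃ n, ∀ u v : List A, LEqv n (k + 1) u v → wordVal f u = wordVal f v := by
  induction k generalizing M with
  | zero => exact IsJTrivial.exists_LEqv h f
  | succ k ih =>
    have hfin : Finite (KCon M).Quotient := Quotient.finite _
    have hop : InRLAux k true (KCon M).Quotientᵐᵒᵖ inferInstance :=
      InRLAux.op (b := false) (M := (KCon M).Quotient) h
    obtain ⟨n, hn⟩ := ih hop fun a => MulOpposite.op ((KCon M).mk' (f a))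
    have hK : ∀ u v : List A, LEqv n (k + 1) u.reverse v.reverse →
        simK (wordVal f u) (wordVal f v) := by
      intro u v huv
      have := hn _ _ huv
      rw [wordVal_op (fun a => (KCon M).mk' (f a)), wordVal_op (fun a => (KCon M).mk' (f a)),
        MulOpposite.op_inj, ← map_wordVal, ← map_wordVal] at this
      exact simK_of_KCon ((KCon M).eq.1 this)
    have key : ∀ c (p : M), rightIdealCard p ≤ c → ∀ u v : List A,
        LEqv (n + c + 1) (k + 2) u v → p * wordVal f u = p * wordVal f v := by
      intro c
      induction c with
      | zero =>
        intro p hp u v huv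
        obtain ⟨t, ht⟩ : ∃ t, p * wordVal f u * t = p := by
          by_contra hd
          have := rightIdealCard_lt hd
          omega
        exact (hK _ _ (huv.reverse_of_succ.mono (by omega))).mul_eq (by rwa [← mul_assoc])
      | succ c ihc =>
        intro p hp u v huv
        by_cases hd : ∃ t, p * wordVal f u * t = p
        · obtain ⟨t, ht⟩ := hd
          exact (hK _ _ (huv.reverse_of_succ.mono (by omega))).mul_eq (by rwa [← mul_assoc])
        obtain ⟨w, a, z, rfl, ⟨t, ht⟩, hd⟩ := exists_first_drop hd
        have haw : a ∉ w := fun haw => hd (h.stable_of_mem ht haw)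
        obtain ⟨w', z', rfl, haw'⟩ := LEqv.exists_split ((huv.mem_iff a).1 (by simp))
        obtain ⟨hw, hz⟩ := huv.2.2 a w z w' z' rfl haw rfl haw'
        have hpw : p * wordVal f w = p * wordVal f w' :=
          (hK _ _ (hw.mono (by omega))).mul_eq (by rwa [← mul_assoc])
        have hlt := rightIdealCard_lt (p := p) (x := wordVal f w * f a)
          (by simpa only [mul_assoc] using hd)
        have := ihc (p * (wordVal f w * f a)) (by omega) z z' hz
        simp only [wordVal_append, wordVal_cons, ← mul_assoc] at this ⊢
        rw [this, hpw]
    refine ⟨n + rightIdealCard (1 : M) + 1, fun u v huv => ?_⟩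
    simpa using key _ 1 le_rfl u v huv

end Green

/-! ## The quotients of the free monoid by the relations -/

section Quotients

variable {A : Type}

theorem LEqv.con_mk_eq {n m : ℕ} {u v : List A} :
    (LEqv.con A n m).mk' (FreeMonoid.ofList u) = (LEqv.con A n m).mk' (FreeMonoid.ofList v) ↔
      LEqv n m u v := (LEqv.con A n m).eq

theorem LEqv.con_mk_append {n m : ℕ} (u v : List A) :
    (LEqv.con A n m).mk' (FreeMonoid.ofList (u ++ v)) =
      (LEqv.con A n m).mk' (FreeMonoid.ofList u) * (LEqv.con A n m).mk' (FreeMonoid.ofList v) := by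
  rw [FreeMonoid.ofList_append, map_mul]

theorem LEqv.con_mk_listNPow {n m : ℕ} (u : List A) (k : ℕ) :
    (LEqv.con A n m).mk' (FreeMonoid.ofList (_root_.listNPow u k)) =
      (LEqv.con A n m).mk' (FreeMonoid.ofList u) ^ k := by
  induction k with
  | zero => exact map_one _
  | succ k ih => rw [_root_.listNPow, con_mk_append, ih, pow_succ']

theorem LEqv.exists_rep {n m : ℕ} (x : (LEqv.con A n m).Quotient) :
    ∃ u : List A, (LEqv.con A n m).mk' (FreeMonoid.ofList u) = x := by
  obtain ⟨u, rfl⟩ := (LEqv.con A n m).mk'_surjective x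
  exact ⟨u.toList, rfl⟩

theorem LEqv.isJTrivial_con (n : ℕ) : IsJTrivial (LEqv.con A n 1).Quotient := by
  have aux : ∀ x y : List A, (∃ a b : (LEqv.con A n 1).Quotient,
      (LEqv.con A n 1).mk' (FreeMonoid.ofList x) =
        a * (LEqv.con A n 1).mk' (FreeMonoid.ofList y) * b) →
      ∀ s : List A, s.length ≤ n → s.Sublist y → s.Sublist x := by
    rintro x y ⟨a, b, h⟩ s hs hsy
    obtain ⟨a, rfl⟩ := exists_rep a
    obtain ⟨b, rfl⟩ := exists_rep b
    rw [← con_mk_append, ← con_mk_append, con_mk_eq] at h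
    exact h.symm.sublist hs (hsy.trans
      ((List.sublist_append_right a y).trans (List.sublist_append_left _ b)))
  intro x y h
  obtain ⟨x, rfl⟩ := exists_rep x
  obtain ⟨y, rfl⟩ := exists_rep y
  have hx := (Set.ext_iff.1 h _).1 ⟨1, 1, by rw [one_mul, mul_one]⟩
  have hy := (Set.ext_iff.1 h _).2 ⟨1, 1, by rw [one_mul, mul_one]⟩
  exact con_mk_eq.2 (LEqv.of_sublist fun s hs => ⟨aux y x hy s hs, aux x y hx s hs⟩)

theorem LEqv.simK_con {n m : ℕ} {u v : List A} (h : LEqv n (m + 1) u.reverse v.reverse) :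
    simK ((LEqv.con A n (m + 2)).mk' (FreeMonoid.ofList u))
      ((LEqv.con A n (m + 2)).mk' (FreeMonoid.ofList v)) := by
  have aux : ∀ u v : List A, LEqv n (m + 1) u.reverse v.reverse →
      ∀ e : (LEqv.con A n (m + 2)).Quotient, IsIdempotentElem e →
      rGreen (e * (LEqv.con A n (m + 2)).mk' (FreeMonoid.ofList u)) e →
      e * (LEqv.con A n (m + 2)).mk' (FreeMonoid.ofList u) =
        e * (LEqv.con A n (m + 2)).mk' (FreeMonoid.ofList v) := by
    intro u v h e he hr
    obtain ⟨e, rfl⟩ := exists_rep e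
    obtain ⟨t, ht⟩ := rGreen_mul_left_iff.1 hr
    obtain ⟨t, rfl⟩ := exists_rep t
    rw [← con_mk_append, ← con_mk_append, con_mk_eq] at ht
    cases n with
    | zero => rw [← con_mk_append, ← con_mk_append, con_mk_eq]; trivial
    | succ n =>
      have hu : ∀ a ∈ u, a ∈ e := fun a ha => (ht.mem_iff a).1 (by simp [ha])
      have hv : ∀ a ∈ v, a ∈ e := fun a ha => hu a (by
        have := (h.mem_iff a).2 (by simpa using ha)
        simpa using this)
      rw [← he.pow_succ_eq n, ← con_mk_listNPow, ← con_mk_append, ← con_mk_append, con_mk_eq]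
      exact LEqv.absorb (LEqv.refl _ _ []) (LEqv.refl _ _ e) h hu hv
  intro e he hr
  exact hr.elim (aux u v h e he) fun hr => (aux v u h.symm e he hr).symm

theorem LEqv.inRLAux_con [Finite A] (k n : ℕ) :
    InRLAux k true (LEqv.con A n (k + 1)).Quotient inferInstance := by
  induction k with
  | zero => exact isJTrivial_con n
  | succ k ih =>
    have hfin : Finite (KCon (LEqv.con A n (k + 2)).Quotient).Quotient := Quotient.finite _
    let q : FreeMonoid A →* (KCon (LEqv.con A n (k + 2)).Quotient).Quotient :=
      (Con.mk' _).comp (Con.mk' _)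
    let g : FreeMonoid A →* (KCon (LEqv.con A n (k + 2)).Quotient).Quotientᵐᵒᵖ :=
      { toFun := fun u => MulOpposite.op (q (FreeMonoid.ofList u.toList.reverse))
        map_one' := by simp
        map_mul' := fun u v => by simp [FreeMonoid.ofList_append] }
    have hg : Function.Surjective g := by
      intro z
      obtain ⟨y, hy⟩ := (KCon _).mk'_surjective z.unop
      obtain ⟨u, rfl⟩ := exists_rep y
      refine ⟨FreeMonoid.ofList u.reverse, congrArg MulOpposite.op ?_⟩
      rw [FreeMonoid.toList_ofList, List.reverse_reverse]
      exact hy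
    have hle : LEqv.con A n (k + 1) ≤ Con.ker g := by
      intro u v huv
      refine congrArg MulOpposite.op ((KCon _).eq.2 (ConGen.Rel.of _ _ (simK_con ?_)))
      rw [List.reverse_reverse, List.reverse_reverse]
      exact huv
    exact (ih.op).of_surjective (homOfAntihom (Con.lift _ _ hle))
      (homOfAntihom_surjective (Con.lift_surjective_of_surjective hle hg))

end Quotients

/-! ## From inseparable words to π-terms -/

section Terms

variable {A : Type}

/-- The letters of a π-term. -/
def PiTerm.letters : PiTerm A → Set A
  | .eps => ∅
  | .letter a => {a}
  | .mul α β => α.letters ∪ β.letters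
  | .pi γ => γ.letters

theorem PiTerm.mem_letters_of_mem (γ : PiTerm A) (K : ℕ) {a : A} (h : a ∈ γ.substNat K) :
    a ∈ γ.letters := by
  induction γ with
  | eps => simp [substNat] at h
  | letter b => simpa [substNat, letters] using h
  | mul α β h1 h2 => exact (List.mem_append.1 h).imp h1 h2
  | pi γ ih => exact ih (mem_listNPow h)

theorem PiTerm.mem_of_mem_letters (γ : PiTerm A) {K : ℕ} (hK : 1 ≤ K) {a : A}
    (h : a ∈ γ.letters) : a ∈ γ.substNat K := by
  induction γ with
  | eps => exact absurd h (Set.notMem_empty a)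
  | letter b => simpa [substNat, letters] using h
  | mul α β h1 h2 => exact List.mem_append.2 (h.imp h1 h2)
  | pi γ ih =>
    obtain ⟨K, rfl⟩ := Nat.exists_eq_add_of_le' hK
    exact List.mem_append.2 (.inl (ih h))

/-- The mirror image of a π-term. -/
def PiTerm.rev : PiTerm A → PiTerm A
  | .eps => .eps
  | .letter a => .letter a
  | .mul α β => .mul β.rev α.rev
  | .pi γ => .pi γ.rev

theorem PiTerm.substNat_rev (γ : PiTerm A) (K : ℕ) :
    γ.rev.substNat K = (γ.substNat K).reverse := by
  induction γ with
  | eps => rfl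
  | letter a => rfl
  | mul α β h1 h2 => simp [rev, substNat, h1, h2]
  | pi γ ih => simp [rev, substNat, ih, reverse_listNPow]

theorem PiTerm.letters_rev (γ : PiTerm A) : γ.rev.letters = γ.letters := by
  induction γ with
  | eps => rfl
  | letter a => rfl
  | mul α β h1 h2 => rw [rev, letters, letters, h1, h2, Set.union_comm]
  | pi γ ih => exact ih

/-- A word as a π-term. -/
def PiTerm.ofWord : List A → PiTerm A
  | [] => .eps
  | a :: u => .mul (.letter a) (ofWord u)

theorem PiTerm.substNat_ofWord (u : List A) (K : ℕ) : (ofWord u).substNat K = u := by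
  induction u with
  | nil => rfl
  | cons a u ih => simp [ofWord, substNat, ih]

theorem PiTerm.letters_ofWord (u : List A) : (ofWord u).letters = {a | a ∈ u} := by
  ext a
  exact ⟨fun h => by simpa [substNat_ofWord] using mem_of_mem_letters _ le_rfl h,
    fun h => mem_letters_of_mem _ 1 (by rwa [substNat_ofWord])⟩

/-- `α` and `β` are `≡_m^X`-equivalent after substitution of all large numbers for `π`. -/
def PiTerm.EventuallyEqv (m : ℕ) (α β : PiTerm A) : Prop :=
  ∀ n, ∃ K₀, ∀ K ≥ K₀, LEqv n m (α.substNat K) (β.substNat K)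

theorem PiTerm.EventuallyEqv.refl (m : ℕ) (α : PiTerm A) : EventuallyEqv m α α :=
  fun _ => ⟨0, fun _ _ => LEqv.refl _ _ _⟩

theorem PiTerm.EventuallyEqv.mul {m : ℕ} {α β α' β' : PiTerm A} (h : EventuallyEqv m α β)
    (h' : EventuallyEqv m α' β') : EventuallyEqv m (.mul α α') (.mul β β') := by
  intro n
  obtain ⟨K, hK⟩ := h n
  obtain ⟨K', hK'⟩ := h' n
  exact ⟨max K K', fun k hk => (hK k (le_trans (le_max_left _ _) hk)).append
    (hK' k (le_trans (le_max_right _ _) hk))⟩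

theorem listNPow_mul_split {l : List A} {n K : ℕ} (h : n ≤ K) :
    listNPow l K = listNPow l n ++ listNPow l (K - n) := by
  rw [← listNPow_add, Nat.add_sub_cancel' h]

theorem PiTerm.EventuallyEqv.absorb {m : ℕ} {α α' ε ε' ρ ρ' : PiTerm A}
    (hα : EventuallyEqv (m + 1) α α') (hε : EventuallyEqv (m + 1) ε ε')
    (hρ : EventuallyEqv m ρ.rev ρ'.rev) (hl : ρ.letters ⊆ ε.letters)
    (hl' : ρ'.letters ⊆ ε'.letters) :
    EventuallyEqv (m + 1) (.mul α (.mul (.pi ε) ρ)) (.mul α' (.mul (.pi ε') ρ')) := by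
  intro n
  obtain ⟨K₁, h₁⟩ := hα n
  obtain ⟨K₂, h₂⟩ := hε (n + 1)
  obtain ⟨K₃, h₃⟩ := hρ n
  refine ⟨K₁ + K₂ + K₃ + n + 1, fun K hK => ?_⟩
  have e₁ := h₁ K (by omega)
  have e₂ := h₂ K (by omega)
  have e₃ := h₃ K (by omega)
  rw [substNat_rev, substNat_rev] at e₃
  simp only [substNat]
  rw [listNPow_mul_split (n := n) (by omega : n ≤ K), List.append_assoc,
    listNPow_mul_split (l := ε'.substNat K) (n := n) (by omega : n ≤ K), List.append_assoc]
  refine LEqv.absorb e₁ e₂.of_succ ?_ ?_ ?_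
  · rw [List.reverse_append, List.reverse_append, reverse_listNPow, reverse_listNPow]
    exact e₃.append (e₂.reverse_of_succ.listNPow _)
  · intro a ha
    exact (List.mem_append.1 ha).elim mem_listNPow fun h =>
      mem_of_mem_letters _ (by omega) (hl (mem_letters_of_mem _ K h))
  · intro a ha
    exact (List.mem_append.1 ha).elim mem_listNPow fun h =>
      mem_of_mem_letters _ (by omega) (hl' (mem_letters_of_mem _ K h))

theorem exists_full_block {u : List A} (hu : u ≠ []) :
    ∃ w a z, u = w ++ a :: z ∧ a ∉ w ∧ ∀ b ∈ u, b ∈ w ∨ b = a := by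
  induction u using List.reverseRecOn with
  | nil => exact absurd rfl hu
  | append_singleton u c ih =>
    by_cases hc : c ∈ u
    · obtain ⟨w, a, z, rfl, h1, h2⟩ := ih (List.ne_nil_of_mem hc)
      refine ⟨w, a, z ++ [c], by simp, h1, fun b hb => h2 b ?_⟩
      rcases List.mem_append.1 hb with hb | hb
      · exact hb
      · rwa [List.mem_singleton.1 hb]
    · exact ⟨u, c, [], rfl, hc, fun b hb => by simpa using hb⟩

theorem exists_full_block_of_eq {u : List A} {B : Set A} (hB : B.Nonempty)
    (hu : {a | a ∈ u} = B) :
    ∃ w a z, u = w ++ a :: z ∧ a ∉ w ∧ a ∈ B ∧ {b | b ∈ w} = B \ {a} ∧ {b | b ∈ z} ⊆ B := by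
  subst hu
  obtain ⟨b, hb⟩ := hB
  obtain ⟨w, a, z, rfl, h1, h2⟩ := exists_full_block (List.ne_nil_of_mem hb)
  refine ⟨w, a, z, rfl, h1, by simp, ?_, fun b hb => by simp [show b ∈ z from hb]⟩
  ext b
  constructor
  · intro hb
    exact ⟨by simp [show b ∈ w from hb], fun h => h1 (h ▸ hb)⟩
  · rintro ⟨hb, hne⟩
    exact (h2 b hb).resolve_right hne

theorem sdiff_singleton_lt {B : Set A} {a : A} (ha : a ∈ B) : B \ {a} < B :=
  ⟨Set.sdiff_subset, fun h => (h ha).2 rfl⟩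

theorem sdiff_singleton_union {B : Set A} {a : A} (ha : a ∈ B) : B \ {a} ∪ {a} = B :=
  Set.sdiff_union_of_subset (Set.singleton_subset_iff.2 ha)

theorem exists_forall_of_antitone {T : Type} [Finite T] {Q : ℕ → T → Prop}
    (hQ : ∀ n x, Q (n + 1) x → Q n x) (h : ∀ n, ∃ x, Q n x) : ∃ x, ∀ n, Q n x := by
  by_contra! hne
  choose g hg using hne
  have := Fintype.ofFinite T
  have hmono : ∀ i j x, i ≤ j → Q j x → Q i x := by
    intro i j x hij
    induction hij with
    | refl => exact id
    | step _ ih => exact fun h => ih (hQ _ _ h)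
  obtain ⟨x, hx⟩ := h (∑ x, g x)
  exact hg x (hmono _ _ x (Finset.single_le_sum (f := g) (fun _ _ => Nat.zero_le _)
    (Finset.mem_univ x)) hx)

end Terms

/-! ### Infinite computations with outputs in a finite monoid -/

section Paths

variable {X T : Type} [Monoid T]

/-- `StepPath step x p y`: a path of steps from `x` to `y` with output `p`. -/
inductive StepPath (step : X → T → X → Prop) : X → T → X → Prop
  | refl (x : X) : StepPath step x 1 x
  | tail {x y z : X} {p e : T} : StepPath step x p y → step y e z → StepPath step x (p * e) z

theorem exists_stable_path [Finite T] {step : X → T → X → Prop}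
    (h : ∀ x, ∃ e y, step x e y) (x₀ : X) :
    ∃ p x e y e' z, StepPath step x₀ p x ∧ StepPath step x e y ∧ step y e' z ∧
      p * (e * e') = p := by
  choose out next hstep using h
  let D : X → ℕ → X × T := fun x d => Nat.rec (x, 1) (fun _ q => (next q.1, q.2 * out q.1)) d
  have hpath : ∀ x d, StepPath step x (D x d).2 (D x d).1 := by
    intro x d
    induction d with
    | zero => exact .refl x
    | succ d ih => exact .tail ih (hstep _)
  have hadd : ∀ i d, D x₀ (i + d) = ((D (D x₀ i).1 d).1, (D x₀ i).2 * (D (D x₀ i).1 d).2) := by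
    intro i d
    induction d with
    | zero => exact Prod.ext rfl (mul_one _).symm
    | succ d ih =>
      change (next (D x₀ (i + d)).1, (D x₀ (i + d)).2 * out (D x₀ (i + d)).1) = _
      rw [ih]
      exact Prod.ext rfl (mul_assoc _ _ _)
  obtain ⟨i, j, hij, he⟩ := Finite.exists_ne_map_eq_of_infinite fun n => (D x₀ n).2
  wlog hlt : i < j generalizing i j
  · exact this j i hij.symm he.symm (by omega)
  obtain ⟨d, rfl⟩ := Nat.exists_eq_add_of_lt hlt
  refine ⟨_, _, _, _, _, _, hpath x₀ i, hpath (D x₀ i).1 d, hstep _, ?_⟩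
  have := congrArg Prod.snd (hadd i (d + 1))
  exact this.symm.trans he.symm

end Paths

section Realization

variable {A M : Type} [Monoid M]

/-- Words with alphabet `B` and values `s`, `t` cannot be distinguished by any `≡_{m,n}^X`. -/
def Indistinguishable (f : A → M) (m : ℕ) (B : Set A) (s t : M) : Prop :=
  ∀ n, ∃ u v : List A, {a | a ∈ u} = B ∧ {a | a ∈ v} = B ∧ wordVal f u = s ∧
    wordVal f v = t ∧ LEqv n m u v

/-- Values `s`, `t` are realized by `≡_m^X`-equivalent π-terms with alphabet `B`. -/
def Realized (f : A → M) (N m : ℕ) (B : Set A) (s t : M) : Prop :=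
  ∃ α β : PiTerm A, α.letters = B ∧ β.letters = B ∧ wordVal f (α.substNat N) = s ∧
    wordVal f (β.substNat N) = t ∧ PiTerm.EventuallyEqv m α β

theorem Realized.mul {f : A → M} {N m : ℕ} {B C : Set A} {s t s' t' : M}
    (h : Realized f N m B s t) (h' : Realized f N m C s' t') :
    Realized f N m (B ∪ C) (s * s') (t * t') := by
  obtain ⟨α, β, rfl, h1, rfl, rfl, h2⟩ := h
  obtain ⟨α', β', rfl, h1', rfl, rfl, h2'⟩ := h'
  exact ⟨.mul α α', .mul β β', rfl, by rw [PiTerm.letters, h1, h1'], wordVal_append _ _ _,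
    wordVal_append _ _ _, h2.mul h2'⟩

theorem Realized.letter (f : A → M) (N m : ℕ) (a : A) : Realized f N m {a} (f a) (f a) :=
  ⟨.letter a, .letter a, rfl, rfl, by simp [PiTerm.substNat], by simp [PiTerm.substNat],
    PiTerm.EventuallyEqv.refl _ _⟩

theorem Indistinguishable.zero {f : A → M} {N : ℕ} {B : Set A} {s t : M}
    (h : Indistinguishable f 0 B s t) : Realized f N 0 B s t := by
  obtain ⟨u, v, hu, hv, rfl, rfl, -⟩ := h 0
  exact ⟨.ofWord u, .ofWord v, by rw [PiTerm.letters_ofWord, hu],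
    by rw [PiTerm.letters_ofWord, hv], by rw [PiTerm.substNat_ofWord],
    by rw [PiTerm.substNat_ofWord], fun n => ⟨0, fun _ _ => LEqv.zero_right _ _ _⟩⟩

theorem Indistinguishable.empty {f : A → M} {N m : ℕ} {s t : M}
    (h : Indistinguishable f m ∅ s t) : Realized f N m ∅ s t := by
  obtain ⟨u, v, hu, hv, rfl, rfl, -⟩ := h 0
  have e : ∀ {u : List A}, {a | a ∈ u} = ∅ → u = [] := fun h =>
    List.eq_nil_iff_forall_not_mem.2 fun a => Set.eq_empty_iff_forall_notMem.1 h a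
  rw [e hu, e hv]
  exact ⟨.eps, .eps, rfl, rfl, rfl, rfl, PiTerm.EventuallyEqv.refl _ _⟩

theorem Indistinguishable.reverse {f : A → M} {m : ℕ} {B : Set A} {s t : M}
    (h : Indistinguishable f (m + 1) B s t) :
    Indistinguishable (fun a => MulOpposite.op (f a)) m B (.op s) (.op t) := by
  intro n
  obtain ⟨u, v, rfl, hv, rfl, rfl, huv⟩ := h (n + 1)
  exact ⟨u.reverse, v.reverse, by simp, by simpa using hv, wordVal_op f u, wordVal_op f v,
    huv.reverse_of_succ⟩

theorem Realized.reverse {f : A → M} {N m : ℕ} {B : Set A} {s t : M}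
    (h : Realized (fun a => MulOpposite.op (f a)) N m B (.op s) (.op t)) :
    ∃ α β : PiTerm A, α.letters = B ∧ β.letters = B ∧ wordVal f (α.substNat N) = s ∧
      wordVal f (β.substNat N) = t ∧ PiTerm.EventuallyEqv m α.rev β.rev := by
  obtain ⟨α, β, h1, h2, h3, h4, h5⟩ := h
  have rr : ∀ γ : PiTerm A, γ.rev.rev = γ := by
    intro γ
    induction γ with
    | eps => rfl
    | letter a => rfl
    | mul α β h1 h2 => rw [PiTerm.rev, PiTerm.rev, h1, h2]
    | pi γ ih => rw [PiTerm.rev, PiTerm.rev, ih]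
  have hv : ∀ (γ : PiTerm A) (s : M),
      wordVal (fun a => MulOpposite.op (f a)) (γ.substNat N) = .op s →
        wordVal f (γ.rev.substNat N) = s := by
    intro γ s h
    rw [PiTerm.substNat_rev]
    apply MulOpposite.op_injective
    rw [← wordVal_op, List.reverse_reverse, h]
  exact ⟨α.rev, β.rev, by rw [PiTerm.letters_rev, h1], by rw [PiTerm.letters_rev, h2], hv _ _ h3,
    hv _ _ h4, by rwa [rr, rr]⟩

theorem wordVal_absorb {f : A → M} {N : ℕ} {α ε ρ : PiTerm A}
    (h : wordVal f (α.substNat N) * wordVal f (ε.substNat N) = wordVal f (α.substNat N)) :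
    wordVal f ((PiTerm.mul α (.mul (.pi ε) ρ)).substNat N) =
      wordVal f (α.substNat N) * wordVal f (ρ.substNat N) := by
  simp only [PiTerm.substNat, wordVal_append, wordVal_listNPow]
  rw [← mul_assoc, mul_pow_eq_self h]

theorem Indistinguishable.exists_step [Finite A] [Finite M] {f : A → M} {m : ℕ} {B : Set A} {s t : M}
    (hB : B.Nonempty) (h : Indistinguishable f (m + 2) B s t) :
    ∃ a ∈ B, ∃ s₀ t₀ C s₁ t₁, Indistinguishable f (m + 2) (B \ {a}) s₀ t₀ ∧
      Indistinguishable f (m + 2) C s₁ t₁ ∧ C ⊆ B ∧ s = s₀ * f a * s₁ ∧ t = t₀ * f a * t₁ := by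
  let Q : ℕ → A × M × M × Set A × M × M → Prop := fun n c =>
    ∃ w z w' z' : List A, {b | b ∈ w} = B \ {c.1} ∧ {b | b ∈ w'} = B \ {c.1} ∧ c.1 ∈ B ∧
      c.2.2.2.1 ⊆ B ∧ {b | b ∈ z} = c.2.2.2.1 ∧ {b | b ∈ z'} = c.2.2.2.1 ∧
      wordVal f w = c.2.1 ∧ wordVal f w' = c.2.2.1 ∧ wordVal f z = c.2.2.2.2.1 ∧
      wordVal f z' = c.2.2.2.2.2 ∧ s = wordVal f w * f c.1 * wordVal f z ∧
      t = wordVal f w' * f c.1 * wordVal f z' ∧ LEqv n (m + 2) w w' ∧ LEqv n (m + 2) z z'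
  have hfin : Finite (Set A) := Set.instFinite
  obtain ⟨⟨a, s₀, t₀, C, s₁, t₁⟩, hc⟩ : ∃ c, ∀ n, Q n c := by
    refine exists_forall_of_antitone ?_ ?_
    · rintro n c ⟨w, z, w', z', h1, h2, h3, h4, h5, h6, h7, h8, h9, h10, h11, h12, h13, h14⟩
      exact ⟨w, z, w', z', h1, h2, h3, h4, h5, h6, h7, h8, h9, h10, h11, h12, h13.of_succ,
        h14.of_succ⟩
    · intro n
      obtain ⟨u, v, hu, hv, rfl, rfl, huv⟩ := h (n + 2)
      obtain ⟨w, a, z, rfl, haw, haB, hw, hz⟩ := exists_full_block_of_eq hB hu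
      obtain ⟨w', z', rfl, haw'⟩ := LEqv.exists_split ((huv.mem_iff a).1 (by simp))
      obtain ⟨h1, h2⟩ := huv.2.2 a w z w' z' rfl haw rfl haw'
      have hw' : {b | b ∈ w'} = B \ {a} := by
        rw [← hw]
        ext b
        have := h1.mem_iff b
        simpa using this.symm
      have hz' : {b | b ∈ z'} = {b | b ∈ z} := Set.ext fun b => (h2.mem_iff b).symm
      exact ⟨(a, wordVal f w, wordVal f w', {b | b ∈ z}, wordVal f z, wordVal f z'), w, z, w', z',
        hw, hw', haB, hz, rfl, hz', rfl, rfl, rfl, rfl, by simp [mul_assoc], by simp [mul_assoc],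
        (LEqv.left_factor huv haw haw').of_succ, h2.of_succ⟩
  obtain ⟨_, _, _, _, _, _, haB, hC, _, _, _, _, _, _, _, _, _, _⟩ := hc 0
  refine ⟨a, haB, s₀, t₀, C, s₁, t₁, fun n => ?_, fun n => ?_, hC, ?_, ?_⟩
  · obtain ⟨w, z, w', z', h1, h2, h3, h4, h5, h6, h7, h8, h9, h10, h11, h12, h13, h14⟩ := hc n
    exact ⟨w, w', h1, h2, h7, h8, h13⟩
  · obtain ⟨w, z, w', z', h1, h2, h3, h4, h5, h6, h7, h8, h9, h10, h11, h12, h13, h14⟩ := hc n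
    exact ⟨z, z', h5, h6, h9, h10, h14⟩
  · obtain ⟨w, z, w', z', h1, h2, h3, h4, h5, h6, h7, h8, h9, h10, h11, h12, h13, h14⟩ := hc 0
    simp only at h7 h9 h11
    rw [h11, h7, h9]
  · obtain ⟨w, z, w', z', h1, h2, h3, h4, h5, h6, h7, h8, h9, h10, h11, h12, h13, h14⟩ := hc 0
    simp only at h8 h10 h12
    rw [h12, h8, h10]

theorem Indistinguishable.realized_add_two [Finite A] [Finite M] {f : A → M} {N m : ℕ}
    (ih : ∀ (B : Set A) (s t : M),
      Indistinguishable (fun a => MulOpposite.op (f a)) (m + 1) B (.op s) (.op t) →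
      Realized (fun a => MulOpposite.op (f a)) N (m + 1) B (.op s) (.op t))
    (B : Set A) (s t : M) (h : Indistinguishable f (m + 2) B s t) : Realized f N (m + 2) B s t := by
  have hfin : Finite (Set A) := Set.instFinite
  induction B using WellFoundedLT.induction generalizing s t with
  | ind B ihB =>
  rcases B.eq_empty_or_nonempty with rfl | hB
  · exact h.empty
  by_contra hR
  let X := {x : M × M // Indistinguishable f (m + 2) B x.1 x.2 ∧ ¬ Realized f N (m + 2) B x.1 x.2}
  let step : X → M × M → X → Prop := fun x e y =>
    Realized f N (m + 2) B e.1 e.2 ∧ x.1 = e * y.1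
  have hstep : ∀ x, ∃ e y, step x e y := by
    rintro ⟨⟨s, t⟩, hx, hx'⟩
    obtain ⟨a, ha, s₀, t₀, C, s₁, t₁, h1, h2, hC, rfl, rfl⟩ := hx.exists_step hB
    have hr : Realized f N (m + 2) B (s₀ * f a) (t₀ * f a) := by
      have := (ihB _ (sdiff_singleton_lt ha) _ _ h1).mul (Realized.letter f N (m + 2) a)
      rwa [sdiff_singleton_union ha] at this
    have hCB : C = B := by
      by_contra hne
      refine hx' ?_
      have := hr.mul (ihB C (lt_of_le_of_ne hC hne) _ _ h2)
      rwa [Set.union_eq_left.2 hC] at this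
    subst hCB
    exact ⟨(s₀ * f a, t₀ * f a), ⟨(s₁, t₁), h2, fun h3 => hx' (by
      have := hr.mul h3
      rwa [Set.union_self] at this)⟩, hr, rfl⟩
  have hpath : ∀ x p y, StepPath step x p y →
      (∃ C ⊆ B, Realized f N (m + 2) C p.1 p.2) ∧ x.1 = p * y.1 := by
    intro x p y hp
    induction hp with
    | refl => exact ⟨⟨∅, Set.empty_subset _, .eps, .eps, rfl, rfl, rfl, rfl,
        PiTerm.EventuallyEqv.refl _ _⟩, (one_mul _).symm⟩
    | tail _ hs ih =>
      obtain ⟨⟨C, hC, h1⟩, h2⟩ := ih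
      exact ⟨⟨_, Set.union_subset hC le_rfl, h1.mul hs.1⟩, by rw [h2, hs.2, mul_assoc]⟩
  obtain ⟨p, x, e, y, e', z, hp, he, hs, hpe⟩ := exists_stable_path hstep ⟨(s, t), h, hR⟩
  obtain ⟨⟨C, hC, hp1⟩, hp2⟩ := hpath _ _ _ hp
  obtain ⟨⟨D, hD, he1⟩, -⟩ := hpath _ _ _ he
  have hE := he1.mul hs.1
  rw [Set.union_eq_right.2 hD] at hE
  obtain ⟨α, α', rfl, ha2, ha3, ha4, ha5⟩ := hp1
  obtain ⟨ε, ε', rfl, hb2, hb3, hb4, hb5⟩ := hE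
  obtain ⟨ρ, ρ', hc1, hc2, hc3, hc4, hc5⟩ := (ih _ _ _ x.2.1.reverse).reverse
  refine hR ⟨_, _, ?_, ?_, ?_, ?_, ha5.absorb hb5 hc5 (by rw [hc1]) (by rw [hc2, hb2])⟩
  · rw [PiTerm.letters, PiTerm.letters, PiTerm.letters, hc1, Set.union_self,
      Set.union_eq_right.2 hC]
  · rw [PiTerm.letters, PiTerm.letters, PiTerm.letters, hc2, hb2, ha2, Set.union_self,
      Set.union_eq_right.2 hC]
  · rw [wordVal_absorb, ha3, hc3]
    · exact (congrArg Prod.fst hp2).symm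
    · rw [ha3, hb3]
      exact congrArg Prod.fst hpe
  · rw [wordVal_absorb, ha4, hc4]
    · exact (congrArg Prod.snd hp2).symm
    · rw [ha4, hb4]
      exact congrArg Prod.snd hpe

end Realization

/-! ### Limits of sequences of words with respect to subwords -/

section Limits

open Filter

variable {A M : Type} [Monoid M]

theorem eventually_const_hyperfilter {T : Type} [Finite T] (g : ℕ → T) :
    ∃ x, ∀ᶠ i in hyperfilter ℕ, g i = x := by
  obtain ⟨x, hx⟩ := Ultrafilter.eq_pure_of_finite ((hyperfilter ℕ).map g)
  refine ⟨x, ?_⟩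
  have : {y | y = x} ∈ (hyperfilter ℕ).map g := by rw [hx]; exact rfl
  exact this

/-- Every subword over `B` of length at most `n` occurs in `u`, whose letters are in `B`. -/
def Rich (B : Set A) (n : ℕ) (u : List A) : Prop :=
  {a | a ∈ u} ⊆ B ∧ ∀ x : List A, x.length ≤ n → {a | a ∈ x} ⊆ B → x.Sublist u

theorem Rich.LEqv {B : Set A} {n : ℕ} {u v : List A} (hu : Rich B n u) (hv : Rich B n v) :
    LEqv n 1 u v :=
  LEqv.of_sublist fun x hx =>
    ⟨fun h => hv.2 x hx fun _ ha => hu.1 (h.subset ha),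
      fun h => hu.2 x hx fun _ ha => hv.1 (h.subset ha)⟩

theorem Rich.zero {B : Set A} {u : List A} (hu : {a | a ∈ u} ⊆ B) : Rich B 0 u :=
  ⟨hu, fun x hx _ => by simp [List.length_eq_zero_iff.1 (Nat.le_zero.1 hx)]⟩

theorem Rich.append_left {B : Set A} {n : ℕ} {u v : List A} (hu : {a | a ∈ u} = B)
    (hv : Rich B n v) : Rich B (n + 1) (u ++ v) := by
  refine ⟨fun _ ha => (List.mem_append.1 ha).elim (fun h => hu.le h) (fun h => hv.1 h), ?_⟩
  intro x hx hxB
  cases x with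
  | nil => simp
  | cons a x =>
    have ha : a ∈ u := hu.ge (hxB (by simp))
    have := (List.singleton_sublist.2 ha).append
      (hv.2 x (by simpa using hx) fun b hb => hxB (by simp [show b ∈ x from hb]))
    simpa using this

theorem Rich.append_subset {B : Set A} {n : ℕ} {u v : List A} (hu : {a | a ∈ u} ⊆ B)
    (hv : Rich B n v) : Rich B n (u ++ v) :=
  ⟨fun _ ha => (List.mem_append.1 ha).elim (fun h => hu h) (fun h => hv.1 h),
    fun x hx hxB => (hv.2 x hx hxB).trans (List.sublist_append_right _ _)⟩

theorem Rich.listNPow_append {B : Set A} {n : ℕ} {u v : List A} (hu : {a | a ∈ u} = B)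
    (hv : {a | a ∈ v} ⊆ B) : Rich B n (listNPow u n ++ v) := by
  induction n with
  | zero => exact Rich.zero hv
  | succ n ih =>
    rw [listNPow, List.append_assoc]
    exact ih.append_left hu

/-- The sequence `u` converges to the π-term `α`, with respect to subwords and along a fixed
nonprincipal ultrafilter. -/
def ConvergesTo (u : ℕ → List A) (α : PiTerm A) : Prop :=
  ∀ n, ∃ K₀, ∀ K ≥ K₀, ∀ᶠ i in hyperfilter ℕ, LEqv n 1 (u i) (α.substNat K)

theorem ConvergesTo.congr {u v : ℕ → List A} {α : PiTerm A} (h : ConvergesTo u α)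
    (huv : ∀ᶠ i in hyperfilter ℕ, v i = u i) : ConvergesTo v α := by
  intro n
  obtain ⟨K₀, hK⟩ := h n
  refine ⟨K₀, fun K hk => ?_⟩
  filter_upwards [hK K hk, huv] with i h1 h2
  rwa [h2]

theorem ConvergesTo.mul {u v : ℕ → List A} {α β : PiTerm A} (h : ConvergesTo u α)
    (h' : ConvergesTo v β) : ConvergesTo (fun i => u i ++ v i) (.mul α β) := by
  intro n
  obtain ⟨K, hK⟩ := h n
  obtain ⟨K', hK'⟩ := h' n
  refine ⟨max K K', fun k hk => ?_⟩
  filter_upwards [hK k (le_trans (le_max_left _ _) hk), hK' k (le_trans (le_max_right _ _) hk)]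
    with i h1 h2
  exact h1.append h2

theorem ConvergesTo.letter (a : A) : ConvergesTo (fun _ => [a]) (.letter a) :=
  fun _ => ⟨0, fun _ _ => Eventually.of_forall fun _ => LEqv.refl _ _ _⟩

/-- The sequence `u` converges to a π-term with alphabet `B` and value `s`. -/
def LimitRealized (f : A → M) (N : ℕ) (B : Set A) (s : M) (u : ℕ → List A) : Prop :=
  ∃ α : PiTerm A, α.letters = B ∧ wordVal f (α.substNat N) = s ∧ ConvergesTo u α

theorem LimitRealized.mul {f : A → M} {N : ℕ} {B C : Set A} {s t : M} {u v : ℕ → List A}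
    (h : LimitRealized f N B s u) (h' : LimitRealized f N C t v) :
    LimitRealized f N (B ∪ C) (s * t) (fun i => u i ++ v i) := by
  obtain ⟨α, rfl, rfl, h1⟩ := h
  obtain ⟨β, rfl, rfl, h2⟩ := h'
  exact ⟨.mul α β, rfl, wordVal_append _ _ _, h1.mul h2⟩

theorem LimitRealized.congr {f : A → M} {N : ℕ} {B : Set A} {s : M} {u v : ℕ → List A}
    (h : LimitRealized f N B s u) (huv : ∀ᶠ i in hyperfilter ℕ, v i = u i) :
    LimitRealized f N B s v :=
  h.imp fun _ h => ⟨h.1, h.2.1, h.2.2.congr huv⟩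

theorem exists_limit_step [Finite A] [Finite M] {f : A → M} {B : Set A} (hB : B.Nonempty)
    {s : M} {u : ℕ → List A} (hu : ∀ᶠ i in hyperfilter ℕ, {a | a ∈ u i} = B ∧ wordVal f (u i) = s) :
    ∃ a ∈ B, ∃ (w z : ℕ → List A) (C : Set A) (p q : M), C ⊆ B ∧ s = p * f a * q ∧
      ∀ᶠ i in hyperfilter ℕ, u i = w i ++ [a] ++ z i ∧ ({b | b ∈ w i} = B \ {a} ∧
        wordVal f (w i) = p) ∧ {b | b ∈ z i} = C ∧ wordVal f (z i) = q := by
  have hfin : Finite (Set A) := Set.instFinite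
  obtain ⟨b₀, hb₀⟩ := hB
  have : ∀ i, ∃ c : List A × A × List A, {a | a ∈ u i} = B → u i = c.1 ++ c.2.1 :: c.2.2 ∧
      c.2.1 ∉ c.1 ∧ c.2.1 ∈ B ∧ {b | b ∈ c.1} = B \ {c.2.1} ∧ {b | b ∈ c.2.2} ⊆ B := by
    intro i
    by_cases hi : {a | a ∈ u i} = B
    · obtain ⟨w, a, z, h⟩ := exists_full_block_of_eq ⟨b₀, hb₀⟩ hi
      exact ⟨(w, a, z), fun _ => h⟩
    · exact ⟨([], b₀, []), fun h => absurd h hi⟩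
  choose c hc using this
  obtain ⟨⟨a, C, p, q⟩, hx⟩ := eventually_const_hyperfilter fun i =>
    ((c i).2.1, {b | b ∈ (c i).2.2}, wordVal f (c i).1, wordVal f (c i).2.2)
  have hev : ∀ᶠ i in hyperfilter ℕ, a ∈ B ∧ C ⊆ B ∧ s = p * f a * q ∧
      u i = (c i).1 ++ [a] ++ (c i).2.2 ∧ ({b | b ∈ (c i).1} = B \ {a} ∧
        wordVal f (c i).1 = p) ∧ {b | b ∈ (c i).2.2} = C ∧ wordVal f (c i).2.2 = q := by
    filter_upwards [hu, hx] with i h1 h2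
    simp only [Prod.mk.injEq] at h2
    obtain ⟨rfl, rfl, rfl, rfl⟩ := h2
    obtain ⟨g1, g2, g3, g4, g5⟩ := hc i h1.1
    exact ⟨g3, g5, by rw [← h1.2, g1]; simp [mul_assoc], by simpa using g1, ⟨g4, rfl⟩, rfl, rfl⟩
  obtain ⟨i, h1, h2, h3, -⟩ := hev.exists
  exact ⟨a, h1, fun i => (c i).1, fun i => (c i).2.2, C, p, q, h2, h3,
    hev.mono fun i h => h.2.2.2⟩

theorem exists_limit [Finite A] [Finite M] {f : A → M} (N : ℕ) (B : Set A) (s : M)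
    (u : ℕ → List A) (hu : ∀ᶠ i in hyperfilter ℕ, {a | a ∈ u i} = B ∧ wordVal f (u i) = s) :
    LimitRealized f N B s u := by
  have hfin : Finite (Set A) := Set.instFinite
  induction B using WellFoundedLT.induction generalizing s u with
  | ind B ihB =>
  rcases B.eq_empty_or_nonempty with rfl | hB
  · have hev : ∀ᶠ i in hyperfilter ℕ, u i = [] ∧ s = 1 := by
      filter_upwards [hu] with i hi
      have h0 : u i = [] := List.eq_nil_iff_forall_not_mem.2 fun a =>
        Set.eq_empty_iff_forall_notMem.1 hi.1 a
      exact ⟨h0, by rw [← hi.2, h0, wordVal_nil]⟩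
    obtain ⟨_, _, rfl⟩ := hev.exists
    refine ⟨.eps, rfl, rfl, fun n => ⟨0, fun K _ => ?_⟩⟩
    filter_upwards [hev] with i hi
    rw [hi.1]
    exact LEqv.refl _ _ _
  by_contra hR
  let X := {x : M × (ℕ → List A) // (∀ᶠ i in hyperfilter ℕ, {a | a ∈ x.2 i} = B ∧
    wordVal f (x.2 i) = x.1) ∧ ¬ LimitRealized f N B x.1 x.2}
  let step : X → M → X → Prop := fun x e y => x.1.1 = e * y.1.1 ∧ ∃ w : ℕ → List A,
    LimitRealized f N B e w ∧
      ∀ᶠ i in hyperfilter ℕ, x.1.2 i = w i ++ y.1.2 i ∧ {b | b ∈ w i} = B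
  have hstep : ∀ x, ∃ e y, step x e y := by
    rintro ⟨⟨s, u⟩, hx, hx'⟩
    obtain ⟨a, ha, w, z, C, p, q, hC, hs, hev⟩ := exists_limit_step hB hx
    have hr : LimitRealized f N B (p * f a) (fun i => w i ++ [a]) := by
      have := (ihB _ (sdiff_singleton_lt ha) p w (hev.mono fun i h => h.2.1)).mul
        (f := f) (N := N) (C := {a}) (t := f a) (v := fun _ => [a])
        ⟨.letter a, rfl, by simp [PiTerm.substNat], ConvergesTo.letter a⟩
      rwa [sdiff_singleton_union ha] at this
    have hcat : ∀ D ⊆ B, LimitRealized f N D q z → False := by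
      intro D hD h
      refine hx' ?_
      have := (hr.mul h).congr (hev.mono fun i h => h.1)
      rw [Set.union_eq_left.2 hD, ← hs] at this
      exact this
    have hCB : C = B := by
      by_contra hne
      exact hcat C hC (ihB C (lt_of_le_of_ne hC hne) _ _ (hev.mono fun i h => h.2.2))
    subst hCB
    refine ⟨p * f a, ⟨(q, z), hev.mono fun i h => h.2.2, hcat _ le_rfl⟩, hs, _, hr, ?_⟩
    filter_upwards [hev] with i h
    refine ⟨h.1, ?_⟩
    rw [← sdiff_singleton_union ha, ← h.2.1.1]
    ext b
    simp [or_comm]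
  have hpath : ∀ x p y, StepPath step x p y →
      (∃ α : PiTerm A, α.letters ⊆ B ∧ wordVal f (α.substNat N) = p) ∧ x.1.1 = p * y.1.1 := by
    intro x p y hp
    induction hp with
    | refl => exact ⟨⟨.eps, Set.empty_subset _, rfl⟩, (one_mul _).symm⟩
    | tail _ hs ih =>
      obtain ⟨⟨α, hα, rfl⟩, h2⟩ := ih
      obtain ⟨hs1, w, ⟨β, hβ, rfl, -⟩, -⟩ := hs
      exact ⟨⟨.mul α β, Set.union_subset hα hβ.le, wordVal_append _ _ _⟩,
        by rw [h2, hs1, mul_assoc]⟩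
  have hrich : ∀ n (x : X), ∀ᶠ i in hyperfilter ℕ, Rich B n (x.1.2 i) := by
    intro n
    induction n with
    | zero => exact fun x => x.2.1.mono fun i h => Rich.zero h.1.le
    | succ n ih =>
      intro x
      obtain ⟨e, y, -, w, -, hw⟩ := hstep x
      filter_upwards [hw, ih y] with i h1 h2
      rw [h1.1]
      exact h2.append_left h1.2
  obtain ⟨p, x, e, y, e', z, hp, he, hs, hpe⟩ := exists_stable_path hstep ⟨(s, u), hu, hR⟩
  obtain ⟨⟨α, hα, rfl⟩, hp2⟩ := hpath _ _ _ hp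
  obtain ⟨⟨β, hβ, rfl⟩, -⟩ := hpath _ _ _ he
  obtain ⟨-, -, ⟨γ, hγ, rfl, -⟩, -⟩ := hs
  obtain ⟨i, hi⟩ := x.2.1.exists
  have hε : (PiTerm.mul β γ).letters = B := by
    rw [PiTerm.letters, hγ, Set.union_eq_right.2 hβ]
  refine hR ⟨.mul α (.mul (.pi (.mul β γ)) (.ofWord (x.1.2 i))), ?_, ?_, fun n => ?_⟩
  · change α.letters ∪ ((PiTerm.mul β γ).letters ∪ _) = B
    rw [PiTerm.letters_ofWord, hi.1, hε, Set.union_self, Set.union_eq_right.2 hα]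
  · rw [wordVal_absorb, PiTerm.substNat_ofWord, hi.2]
    · exact hp2.symm
    · rw [PiTerm.substNat, wordVal_append]
      exact hpe
  · refine ⟨n + 1, fun K hK => ?_⟩
    filter_upwards [hrich n ⟨(s, u), hu, hR⟩] with j hj
    refine hj.LEqv ?_
    simp only [PiTerm.substNat, PiTerm.substNat_ofWord]
    rw [listNPow_mul_split (n := n) (by omega : n ≤ K), List.append_assoc]
    have hl : {a | a ∈ β.substNat K ++ γ.substNat K} = B := by
      rw [← hε]
      exact Set.ext fun a => ⟨fun h => PiTerm.mem_letters_of_mem (.mul β γ) K h,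
        fun h => PiTerm.mem_of_mem_letters (.mul β γ) (by omega) h⟩
    refine Rich.append_subset (fun a ha => hα (PiTerm.mem_letters_of_mem _ K ha))
      (Rich.listNPow_append hl fun a ha => ?_)
    exact (List.mem_append.1 ha).elim (fun h => hl.le (mem_listNPow h)) fun h => hi.1.le h

theorem Indistinguishable.realized_one [Finite A] [Finite M] {f : A → M} (N : ℕ)
    {B : Set A} {s t : M} (h : Indistinguishable f 1 B s t) : Realized f N 1 B s t := by
  choose u v h using h
  obtain ⟨α, h1, h2, hα⟩ := exists_limit N B s u
    (Eventually.of_forall fun i => ⟨(h i).1, (h i).2.2.1⟩)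
  obtain ⟨β, h3, h4, hβ⟩ := exists_limit N B t v
    (Eventually.of_forall fun i => ⟨(h i).2.1, (h i).2.2.2.1⟩)
  refine ⟨α, β, h1, h3, h2, h4, fun n => ?_⟩
  obtain ⟨K, hK⟩ := hα n
  obtain ⟨K', hK'⟩ := hβ n
  refine ⟨max K K', fun k hk => ?_⟩
  have hge : ∀ᶠ i in hyperfilter ℕ, n ≤ i := by
    have := Filter.hyperfilter_le_cofinite (α := ℕ)
    rw [Nat.cofinite_eq_atTop] at this
    exact this (eventually_ge_atTop n)
  obtain ⟨i, g1, g2, g3⟩ := ((hK k (le_trans (le_max_left _ _) hk)).and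
    ((hK' k (le_trans (le_max_right _ _) hk)).and hge)).exists
  exact g1.symm.trans (((h i).2.2.2.2.mono g3).trans g2)

theorem Indistinguishable.realized [Finite A] {m : ℕ} {M : Type} [Monoid M] [Finite M]
    {f : A → M} (N : ℕ) {B : Set A} {s t : M} (h : Indistinguishable f m B s t) :
    Realized f N m B s t := by
  induction m generalizing M B with
  | zero => exact h.zero
  | succ m ih =>
    cases m with
    | zero => exact h.realized_one N
    | succ m => exact h.realized_add_two (f := f) (N := N) (fun B s t h => ih h)

end Limits

/-! ## Ehrenfeucht-Fraïssé games on generalized words -/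

namespace GWord

variable {A : Type}

/-- A label-preserving isomorphism of generalized words. -/
def Iso (u v : GWord A) : Prop :=
  ∃ e : u.P → v.P, StrictMono e ∧ Function.Surjective e ∧ ∀ p, v.w (e p) = u.w p

/-- Duplicator wins the `k`-round game, where every move splits both words. -/
def EF : ℕ → GWord A → GWord A → Prop
  | 0, _, _ => True
  | k + 1, u, v =>
    (∀ p : u.P, ∃ q : v.P, u.w p = v.w q ∧ EF k (u.restrict {r | r < p}) (v.restrict {r | r < q}) ∧
      EF k (u.restrict {r | p < r}) (v.restrict {r | q < r})) ∧
    (∀ q : v.P, ∃ p : u.P, u.w p = v.w q ∧ EF k (u.restrict {r | r < p}) (v.restrict {r | r < q}) ∧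
      EF k (u.restrict {r | p < r}) (v.restrict {r | q < r}))

theorem iso_restrict {u v : GWord A} {s : Set v.P} (f : u.P → v.P) (hf : StrictMono f)
    (hw : ∀ p, v.w (f p) = u.w p) (hs : ∀ q, q ∈ s ↔ ∃ p, f p = q) : Iso u (v.restrict s) :=
  ⟨fun p => ⟨f p, (hs _).2 ⟨p, rfl⟩⟩, fun _ _ h => hf h,
    fun q => ((hs q.1).1 q.2).imp fun _ h => Subtype.ext h, hw⟩

theorem EF.symm {k : ℕ} {u v : GWord A} (h : EF k u v) : EF k v u := by
  induction k generalizing u v with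
  | zero => trivial
  | succ k ih =>
    exact ⟨fun p => (h.2 p).imp fun q hq => ⟨hq.1.symm, ih hq.2.1, ih hq.2.2⟩,
      fun p => (h.1 p).imp fun q hq => ⟨hq.1.symm, ih hq.2.1, ih hq.2.2⟩⟩

theorem EF.trans {k : ℕ} {u v x : GWord A} (h : EF k u v) (h' : EF k v x) : EF k u x := by
  induction k generalizing u v x with
  | zero => trivial
  | succ k ih =>
    constructor
    · intro p
      obtain ⟨q, h1, h2, h3⟩ := h.1 p
      obtain ⟨r, h4, h5, h6⟩ := h'.1 q
      exact ⟨r, h1.trans h4, ih h2 h5, ih h3 h6⟩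
    · intro r
      obtain ⟨q, h4, h5, h6⟩ := h'.2 r
      obtain ⟨p, h1, h2, h3⟩ := h.2 q
      exact ⟨p, h1.trans h4, ih h2 h5, ih h3 h6⟩

theorem EF.of_succ {k : ℕ} {u v : GWord A} (h : EF (k + 1) u v) : EF k u v := by
  induction k generalizing u v with
  | zero => trivial
  | succ k ih =>
    exact ⟨fun p => (h.1 p).imp fun q hq => ⟨hq.1, ih hq.2.1, ih hq.2.2⟩,
      fun p => (h.2 p).imp fun q hq => ⟨hq.1, ih hq.2.1, ih hq.2.2⟩⟩

theorem Iso.restrict {u v : GWord A} {e : u.P → v.P} (he : StrictMono e)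
    (hs : Function.Surjective e) (hw : ∀ p, v.w (e p) = u.w p) {s : Set u.P} {t : Set v.P}
    (hst : ∀ p, e p ∈ t ↔ p ∈ s) : Iso (u.restrict s) (v.restrict t) :=
  iso_restrict (u := u.restrict s) (fun p => e p.1) (fun _ _ h => he h) (fun p => hw p.1)
    fun q => by
      obtain ⟨p, rfl⟩ := hs q
      exact ⟨fun h => ⟨⟨p, (hst p).1 h⟩, rfl⟩, fun ⟨r, hr⟩ => hr ▸ (hst r.1).2 r.2⟩

theorem Iso.EF {k : ℕ} {u v : GWord A} (h : Iso u v) : EF k u v := by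
  induction k generalizing u v with
  | zero => trivial
  | succ k ih =>
    obtain ⟨e, he, hs, hw⟩ := h
    have key : ∀ p, u.w p = v.w (e p) ∧
        GWord.EF k (u.restrict {r | r < p}) (v.restrict {r | r < e p}) ∧
        GWord.EF k (u.restrict {r | p < r}) (v.restrict {r | e p < r}) := fun p =>
      ⟨(hw p).symm, ih (Iso.restrict he hs hw fun _ => he.lt_iff_lt),
        ih (Iso.restrict he hs hw fun _ => he.lt_iff_lt)⟩
    refine ⟨fun p => ⟨e p, key p⟩, fun q => ?_⟩
    obtain ⟨p, rfl⟩ := hs q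
    exact ⟨p, key p⟩

theorem EF.refl (k : ℕ) (u : GWord A) : EF k u u :=
  Iso.EF ⟨id, strictMono_id, Function.surjective_id, fun _ => rfl⟩

section Append

variable (u v : GWord A)

theorem append_restrict_lt_inl (p : u.P) : Iso (u.restrict {r | r < p})
    ((u.append v).restrict {r | r < (toLex (Sum.inl p) : u.P ⊕ₗ v.P)}) := by
  refine iso_restrict (v := u.append v) (fun r => (toLex (Sum.inl r.1) : u.P ⊕ₗ v.P))
    (fun _ _ h => Sum.Lex.inl_lt_inl_iff.2 h) (fun _ => rfl) ?_
  intro q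
  change (q : u.P ⊕ₗ v.P) < toLex (Sum.inl p) ↔ _
  constructor
  · intro h
    rcases q with q | q
    · exact ⟨⟨q, Sum.Lex.inl_lt_inl_iff.1 h⟩, rfl⟩
    · exact absurd h Sum.Lex.not_inr_lt_inl
  · rintro ⟨r, rfl⟩
    exact Sum.Lex.inl_lt_inl_iff.2 r.2

theorem append_restrict_gt_inl (p : u.P) : Iso ((u.restrict {r | p < r}).append v)
    ((u.append v).restrict {r | (toLex (Sum.inl p) : u.P ⊕ₗ v.P) < r}) := by
  refine iso_restrict (u := (u.restrict {r | p < r}).append v) (v := u.append v)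
    (fun r => (toLex (Sum.map Subtype.val id (ofLex r)) : u.P ⊕ₗ v.P)) ?_ ?_ ?_
  · rintro (a | a) (b | b) h
    · have h' : a < b := Sum.Lex.inl_lt_inl_iff.1 h
      exact Sum.Lex.inl_lt_inl_iff.2 h'
    · exact Sum.Lex.inl_lt_inr _ _
    · exact absurd h Sum.Lex.not_inr_lt_inl
    · exact Sum.Lex.inr_lt_inr_iff.2 (Sum.Lex.inr_lt_inr_iff.1 h)
  · rintro (a | a) <;> rfl
  · intro q
    change toLex (Sum.inl p) < (q : u.P ⊕ₗ v.P) ↔ _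
    constructor
    · intro h
      rcases q with q | q
      · exact ⟨toLex (Sum.inl ⟨q, Sum.Lex.inl_lt_inl_iff.1 h⟩), rfl⟩
      · exact ⟨toLex (Sum.inr q), rfl⟩
    · rintro ⟨r | r, rfl⟩
      · exact Sum.Lex.inl_lt_inl_iff.2 r.2
      · exact Sum.Lex.inl_lt_inr _ _

theorem append_restrict_gt_inr (p : v.P) : Iso (v.restrict {r | p < r})
    ((u.append v).restrict {r | (toLex (Sum.inr p) : u.P ⊕ₗ v.P) < r}) := by
  refine iso_restrict (v := u.append v) (fun r => (toLex (Sum.inr r.1) : u.P ⊕ₗ v.P))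
    (fun _ _ h => Sum.Lex.inr_lt_inr_iff.2 h) (fun _ => rfl) ?_
  intro q
  change toLex (Sum.inr p) < (q : u.P ⊕ₗ v.P) ↔ _
  constructor
  · intro h
    rcases q with q | q
    · exact absurd h Sum.Lex.not_inr_lt_inl
    · exact ⟨⟨q, Sum.Lex.inr_lt_inr_iff.1 h⟩, rfl⟩
  · rintro ⟨r, rfl⟩
    exact Sum.Lex.inr_lt_inr_iff.2 r.2

theorem append_restrict_lt_inr (p : v.P) : Iso (u.append (v.restrict {r | r < p}))
    ((u.append v).restrict {r | r < (toLex (Sum.inr p) : u.P ⊕ₗ v.P)}) := by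
  refine iso_restrict (u := u.append (v.restrict {r | r < p})) (v := u.append v)
    (fun r => (toLex (Sum.map id Subtype.val (ofLex r)) : u.P ⊕ₗ v.P)) ?_ ?_ ?_
  · rintro (a | a) (b | b) h
    · exact Sum.Lex.inl_lt_inl_iff.2 (Sum.Lex.inl_lt_inl_iff.1 h)
    · exact Sum.Lex.inl_lt_inr _ _
    · exact absurd h Sum.Lex.not_inr_lt_inl
    · have h' : a < b := Sum.Lex.inr_lt_inr_iff.1 h
      exact Sum.Lex.inr_lt_inr_iff.2 h'
  · rintro (a | a) <;> rfl
  · intro q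
    change (q : u.P ⊕ₗ v.P) < toLex (Sum.inr p) ↔ _
    constructor
    · intro h
      rcases q with q | q
      · exact ⟨toLex (Sum.inl q), rfl⟩
      · exact ⟨toLex (Sum.inr ⟨q, Sum.Lex.inr_lt_inr_iff.1 h⟩), rfl⟩
    · rintro ⟨r | r, rfl⟩
      · exact Sum.Lex.inl_lt_inr _ _
      · exact Sum.Lex.inr_lt_inr_iff.2 r.2

end Append

theorem EF.append {k : ℕ} {u v u' v' : GWord A} (h : EF k u u') (h' : EF k v v') :
    EF k (u.append v) (u'.append v') := by
  induction k generalizing u v u' v' with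
  | zero => trivial
  | succ k ih =>
    have hl : ∀ p q, EF k (u.restrict {r | r < p}) (u'.restrict {r | r < q}) →
        EF k (u.restrict {r | p < r}) (u'.restrict {r | q < r}) →
        EF k ((u.append v).restrict {r | r < (toLex (Sum.inl p) : u.P ⊕ₗ v.P)})
          ((u'.append v').restrict {r | r < (toLex (Sum.inl q) : u'.P ⊕ₗ v'.P)}) ∧
        EF k ((u.append v).restrict {r | (toLex (Sum.inl p) : u.P ⊕ₗ v.P) < r})
          ((u'.append v').restrict {r | (toLex (Sum.inl q) : u'.P ⊕ₗ v'.P) < r}) :=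
      fun p q h2 h3 =>
        ⟨((append_restrict_lt_inl u v p).EF.symm.trans h2).trans
          (append_restrict_lt_inl u' v' q).EF,
        ((append_restrict_gt_inl u v p).EF.symm.trans (ih h3 h'.of_succ)).trans
          (append_restrict_gt_inl u' v' q).EF⟩
    have hr : ∀ p q, EF k (v.restrict {r | r < p}) (v'.restrict {r | r < q}) →
        EF k (v.restrict {r | p < r}) (v'.restrict {r | q < r}) →
        EF k ((u.append v).restrict {r | r < (toLex (Sum.inr p) : u.P ⊕ₗ v.P)})
          ((u'.append v').restrict {r | r < (toLex (Sum.inr q) : u'.P ⊕ₗ v'.P)}) ∧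
        EF k ((u.append v).restrict {r | (toLex (Sum.inr p) : u.P ⊕ₗ v.P) < r})
          ((u'.append v').restrict {r | (toLex (Sum.inr q) : u'.P ⊕ₗ v'.P) < r}) :=
      fun p q h2 h3 =>
        ⟨((append_restrict_lt_inr u v p).EF.symm.trans (ih h.of_succ h2)).trans
          (append_restrict_lt_inr u' v' q).EF,
        ((append_restrict_gt_inr u v p).EF.symm.trans h3).trans
          (append_restrict_gt_inr u' v' q).EF⟩
    constructor
    · rintro (p | p)
      · obtain ⟨q, h1, h2, h3⟩ := h.1 p
        exact ⟨toLex (Sum.inl q), h1, hl p q h2 h3⟩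
      · obtain ⟨q, h1, h2, h3⟩ := h'.1 p
        exact ⟨toLex (Sum.inr q), h1, hr p q h2 h3⟩
    · rintro (q | q)
      · obtain ⟨p, h1, h2, h3⟩ := h.2 q
        exact ⟨toLex (Sum.inl p), h1, hl p q h2 h3⟩
      · obtain ⟨p, h1, h2, h3⟩ := h'.2 q
        exact ⟨toLex (Sum.inr p), h1, hr p q h2 h3⟩

end GWord

namespace GWord

variable {A : Type}

/-- A linear order as a generalized word over a one-letter alphabet. -/
def ordW (ν : Type) [LinearOrder ν] : GWord Unit :=
  ⟨ν, inferInstance, fun _ => ()⟩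

theorem gpow_restrict_lt (u : GWord A) (ν : Type) [LinearOrder ν] (i : ν) (p : u.P) :
    Iso ((u.gpow {j // j ∈ {j | j < i}}).append (u.restrict {r | r < p}))
      ((u.gpow ν).restrict {r | r < (toLex (i, p) : ν ×ₗ u.P)}) := by
  refine iso_restrict (u := (u.gpow {j // j ∈ {j | j < i}}).append (u.restrict {r | r < p}))
    (v := u.gpow ν)
    (fun r => Sum.elim (fun x : {j // j ∈ {j | j < i}} ×ₗ u.P =>
        (toLex ((ofLex x).1.1, (ofLex x).2) : ν ×ₗ u.P))
      (fun x : {r // r ∈ {r | r < p}} => (toLex (i, x.1) : ν ×ₗ u.P)) (ofLex r)) ?_ ?_ ?_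
  · rintro (⟨a, x⟩ | a) (⟨b, y⟩ | b) h
    · have h1 : (toLex (a, x) : {j // j ∈ {j | j < i}} ×ₗ u.P) < toLex (b, y) :=
        Sum.Lex.inl_lt_inl_iff.1 h
      refine Prod.Lex.toLex_lt_toLex.2 ?_
      exact (Prod.Lex.toLex_lt_toLex.1 h1).imp id fun h => ⟨congrArg Subtype.val h.1, h.2⟩
    · exact Prod.Lex.toLex_lt_toLex.2 (Or.inl a.2)
    · exact absurd h Sum.Lex.not_inr_lt_inl
    · have h' : a < b := Sum.Lex.inr_lt_inr_iff.1 h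
      exact Prod.Lex.toLex_lt_toLex.2 (Or.inr ⟨rfl, h'⟩)
  · rintro (a | a) <;> rfl
  · rintro ⟨j, q⟩
    change (toLex (j, q) : ν ×ₗ u.P) < toLex (i, p) ↔ _
    rw [Prod.Lex.toLex_lt_toLex]
    constructor
    · rintro (h | ⟨h, h'⟩)
      · exact ⟨toLex (Sum.inl (toLex (⟨j, h⟩, q))), rfl⟩
      · exact ⟨toLex (Sum.inr ⟨q, h'⟩), by rw [show j = i from h]; rfl⟩
    · rintro ⟨⟨a, x⟩ | a, h⟩ <;> obtain ⟨rfl, rfl⟩ := Prod.mk.inj h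
      · exact Or.inl a.2
      · exact Or.inr ⟨rfl, a.2⟩

theorem gpow_restrict_gt (u : GWord A) (ν : Type) [LinearOrder ν] (i : ν) (p : u.P) :
    Iso ((u.restrict {r | p < r}).append (u.gpow {j // j ∈ {j | i < j}}))
      ((u.gpow ν).restrict {r | (toLex (i, p) : ν ×ₗ u.P) < r}) := by
  refine iso_restrict (u := (u.restrict {r | p < r}).append (u.gpow {j // j ∈ {j | i < j}}))
    (v := u.gpow ν)
    (fun r => Sum.elim (fun x : {r // r ∈ {r | p < r}} => (toLex (i, x.1) : ν ×ₗ u.P))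
      (fun x : {j // j ∈ {j | i < j}} ×ₗ u.P =>
        (toLex ((ofLex x).1.1, (ofLex x).2) : ν ×ₗ u.P)) (ofLex r)) ?_ ?_ ?_
  · rintro (a | ⟨a, x⟩) (b | ⟨b, y⟩) h
    · have h' : a < b := Sum.Lex.inl_lt_inl_iff.1 h
      exact Prod.Lex.toLex_lt_toLex.2 (Or.inr ⟨rfl, h'⟩)
    · exact Prod.Lex.toLex_lt_toLex.2 (Or.inl b.2)
    · exact absurd h Sum.Lex.not_inr_lt_inl
    · have h1 : (toLex (a, x) : {j // j ∈ {j | i < j}} ×ₗ u.P) < toLex (b, y) :=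
        Sum.Lex.inr_lt_inr_iff.1 h
      refine Prod.Lex.toLex_lt_toLex.2 ?_
      exact (Prod.Lex.toLex_lt_toLex.1 h1).imp id fun h => ⟨congrArg Subtype.val h.1, h.2⟩
  · rintro (a | a) <;> rfl
  · rintro ⟨j, q⟩
    change (toLex (i, p) : ν ×ₗ u.P) < toLex (j, q) ↔ _
    rw [Prod.Lex.toLex_lt_toLex]
    constructor
    · rintro (h | ⟨h, h'⟩)
      · exact ⟨toLex (Sum.inr (toLex (⟨j, h⟩, q))), rfl⟩
      · exact ⟨toLex (Sum.inl ⟨q, h'⟩), by rw [← show i = j from h]; rfl⟩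
    · rintro ⟨a | ⟨a, x⟩, h⟩ <;> obtain ⟨rfl, rfl⟩ := Prod.mk.inj h
      · exact Or.inr ⟨rfl, a.2⟩
      · exact Or.inl a.2

theorem EF.gpow {k : ℕ} {ν ν' : Type} [LinearOrder ν] [LinearOrder ν'] {u u' : GWord A}
    (h : EF k (ordW ν) (ordW ν')) (h' : EF k u u') : EF k (u.gpow ν) (u'.gpow ν') := by
  induction k generalizing ν ν' with
  | zero => trivial
  | succ k ih =>
    have key : ∀ (i : ν) (j : ν') (p : u.P) (q : u'.P),
        EF k (ordW {r // r ∈ {r | r < i}}) (ordW {r // r ∈ {r | r < j}}) →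
        EF k (ordW {r // r ∈ {r | i < r}}) (ordW {r // r ∈ {r | j < r}}) →
        EF k (u.restrict {r | r < p}) (u'.restrict {r | r < q}) →
        EF k (u.restrict {r | p < r}) (u'.restrict {r | q < r}) →
        EF k ((u.gpow ν).restrict {r | r < (toLex (i, p) : ν ×ₗ u.P)})
          ((u'.gpow ν').restrict {r | r < (toLex (j, q) : ν' ×ₗ u'.P)}) ∧
        EF k ((u.gpow ν).restrict {r | (toLex (i, p) : ν ×ₗ u.P) < r})
          ((u'.gpow ν').restrict {r | (toLex (j, q) : ν' ×ₗ u'.P) < r}) :=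
      fun i j p q h1 h2 h3 h4 =>
        ⟨((gpow_restrict_lt u ν i p).EF.symm.trans ((ih h1 h'.of_succ).append h3)).trans
          (gpow_restrict_lt u' ν' j q).EF,
        ((gpow_restrict_gt u ν i p).EF.symm.trans (h4.append (ih h2 h'.of_succ))).trans
          (gpow_restrict_gt u' ν' j q).EF⟩
    constructor
    · rintro ⟨i, p⟩
      obtain ⟨j, -, h1, h2⟩ := h.1 i
      obtain ⟨q, hw, h3, h4⟩ := h'.1 p
      exact ⟨toLex (j, q), hw, key i j p q h1 h2 h3 h4⟩
    · rintro ⟨j, q⟩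
      obtain ⟨i, -, h1, h2⟩ := h.2 j
      obtain ⟨p, hw, h3, h4⟩ := h'.2 q
      exact ⟨toLex (i, p), hw, key i j p q h1 h2 h3 h4⟩

/-! ### Long finite orders and `ω + ω*` -/

section Orders

variable {k : ℕ}

theorem fin_restrict_lt {n : ℕ} (i : Fin n) :
    Iso (ordW (Fin i)) ((ordW (Fin n)).restrict {r | r < i}) :=
  iso_restrict (u := ordW (Fin i)) (v := ordW (Fin n))
    (fun r : Fin i => (⟨r, by omega⟩ : Fin n)) (fun _ _ h => h) (fun _ => rfl) fun q =>
      ⟨fun h => ⟨(⟨Fin.val (n := n) q, h⟩ : Fin i), rfl⟩,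
        fun ⟨r, hr⟩ => hr ▸ Fin.isLt (n := i) r⟩

theorem fin_restrict_gt {n : ℕ} (i : Fin n) :
    Iso (ordW (Fin (n - 1 - i))) ((ordW (Fin n)).restrict {r | i < r}) :=
  iso_restrict (u := ordW (Fin (n - 1 - i))) (v := ordW (Fin n))
    (fun r : Fin (n - 1 - i) => (⟨i + 1 + r, by omega⟩ : Fin n))
    (fun a b h => Fin.lt_def.2 (Nat.add_lt_add_left (Fin.lt_def.1 h) _)) (fun _ => rfl) fun q => by
      change Fin n at q
      constructor
      · intro h
        have h' : (i : ℕ) < q := h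
        exact ⟨(⟨(q : Fin n).1 - (i + 1), by omega⟩ : Fin (n - 1 - i)), Fin.ext (by simp; omega)⟩
      · rintro ⟨r, rfl⟩
        change Fin (n - 1 - i) at r
        exact Fin.lt_def.2 (by simp; omega)

theorem oo_restrict_lt_inl (i : ℕ) :
    Iso (ordW (Fin i)) ((ordW OO).restrict {r | r < (toLex (Sum.inl i) : OO)}) :=
  iso_restrict (u := ordW (Fin i)) (v := ordW OO)
    (fun r : Fin i => (toLex (Sum.inl (r : ℕ)) : OO))
    (fun _ _ h => Sum.Lex.inl_lt_inl_iff.2 h) (fun _ => rfl) fun q => by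
      change (q : OO) < toLex (Sum.inl i) ↔ _
      constructor
      · intro h
        rcases q with q | q
        · exact ⟨(⟨q, Sum.Lex.inl_lt_inl_iff.1 h⟩ : Fin i), rfl⟩
        · exact absurd h Sum.Lex.not_inr_lt_inl
      · rintro ⟨r, rfl⟩
        exact Sum.Lex.inl_lt_inl_iff.2 r.2

theorem oo_restrict_gt_inr (i : ℕ) :
    Iso (ordW (Fin i)) ((ordW OO).restrict {r | (toLex (Sum.inr (OrderDual.toDual i)) : OO) < r}) :=
  iso_restrict (u := ordW (Fin i)) (v := ordW OO)
    (fun r : Fin i => (toLex (Sum.inr (OrderDual.toDual (i - 1 - r : ℕ))) : OO))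
    (fun a b h => Sum.Lex.inr_lt_inr_iff.2 (OrderDual.toDual_lt_toDual.2 (by
      change Fin i at a b
      have h' : (a : ℕ) < b := h
      omega))) (fun _ => rfl) fun q => by
      change toLex (Sum.inr _) < (q : OO) ↔ _
      constructor
      · intro h
        rcases q with q | q
        · exact absurd h Sum.Lex.not_inr_lt_inl
        · have h₁ : OrderDual.toDual i < q := Sum.Lex.inr_lt_inr_iff.1 h
          have h' : (OrderDual.ofDual q : ℕ) < i := h₁
          refine ⟨(⟨i - 1 - OrderDual.ofDual q, by omega⟩ : Fin i), ?_⟩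
          have : i - 1 - (i - 1 - OrderDual.ofDual q) = OrderDual.ofDual q := by omega
          exact congrArg (fun x : ℕ => (toLex (Sum.inr (OrderDual.toDual x)) : OO)) this
      · rintro ⟨r, rfl⟩
        change Fin i at r
        exact Sum.Lex.inr_lt_inr_iff.2 (OrderDual.toDual_lt_toDual.2 (by omega))

theorem oo_restrict_gt_inl (i : ℕ) :
    Iso (ordW OO) ((ordW OO).restrict {r | (toLex (Sum.inl i) : OO) < r}) := by
  refine iso_restrict (u := ordW OO) (v := ordW OO)
    (fun r : OO => (toLex (Sum.map (fun j => i + 1 + j) id (ofLex r)) : OO)) ?_ (fun _ => rfl) ?_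
  · rintro (a | a) (b | b) h
    · have h' : a < b := Sum.Lex.inl_lt_inl_iff.1 h
      exact Sum.Lex.inl_lt_inl_iff.2 (Nat.add_lt_add_left h' _)
    · exact Sum.Lex.inl_lt_inr _ _
    · exact absurd h Sum.Lex.not_inr_lt_inl
    · have h' : a < b := Sum.Lex.inr_lt_inr_iff.1 h
      exact Sum.Lex.inr_lt_inr_iff.2 h'
  · intro q
    change toLex (Sum.inl i) < (q : OO) ↔ _
    constructor
    · intro h
      rcases q with q | q
      · have h' : i < q := Sum.Lex.inl_lt_inl_iff.1 h
        refine ⟨(toLex (Sum.inl (q - (i + 1))) : OO), ?_⟩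
        have : i + 1 + (q - (i + 1)) = q := by omega
        exact congrArg (fun x : ℕ => (toLex (Sum.inl x) : OO)) this
      · exact ⟨(toLex (Sum.inr q) : OO), rfl⟩
    · rintro ⟨r | r, rfl⟩
      · exact Sum.Lex.inl_lt_inl_iff.2 (show i < i + 1 + r by omega)
      · exact Sum.Lex.inl_lt_inr _ _

theorem oo_restrict_lt_inr (i : ℕ) :
    Iso (ordW OO) ((ordW OO).restrict {r | r < (toLex (Sum.inr (OrderDual.toDual i)) : OO)}) := by
  refine iso_restrict (u := ordW OO) (v := ordW OO)
    (fun r : OO => (toLex (Sum.map id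
      (fun j : ℕᵒᵈ => OrderDual.toDual (i + 1 + OrderDual.ofDual j)) (ofLex r)) : OO))
      ?_ (fun _ => rfl) ?_
  · rintro (a | a) (b | b) h
    · have h' : a < b := Sum.Lex.inl_lt_inl_iff.1 h
      exact Sum.Lex.inl_lt_inl_iff.2 h'
    · exact Sum.Lex.inl_lt_inr _ _
    · exact absurd h Sum.Lex.not_inr_lt_inl
    · have h' : a < b := Sum.Lex.inr_lt_inr_iff.1 h
      exact Sum.Lex.inr_lt_inr_iff.2
        (OrderDual.toDual_lt_toDual.2 (Nat.add_lt_add_left (OrderDual.ofDual_lt_ofDual.2 h') _))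
  · intro q
    change (q : OO) < toLex (Sum.inr _) ↔ _
    constructor
    · intro h
      rcases q with q | q
      · exact ⟨(toLex (Sum.inl q) : OO), rfl⟩
      · have h₁ : q < OrderDual.toDual i := Sum.Lex.inr_lt_inr_iff.1 h
        have h' : i < (OrderDual.ofDual q : ℕ) := h₁
        refine ⟨(toLex (Sum.inr (OrderDual.toDual (OrderDual.ofDual q - (i + 1)))) : OO), ?_⟩
        have : i + 1 + (OrderDual.ofDual q - (i + 1)) = OrderDual.ofDual q := by omega
        exact congrArg (fun x : ℕ => (toLex (Sum.inr (OrderDual.toDual x)) : OO)) this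
    · rintro ⟨r | r, rfl⟩
      · exact Sum.Lex.inl_lt_inr _ _
      · exact Sum.Lex.inr_lt_inr_iff.2
          (OrderDual.toDual_lt_toDual.2 (show i < i + 1 + OrderDual.ofDual r by omega))

/-- Finite orders with at least `2 ^ k - 1` elements look like `ω + ω*` in `k` rounds. -/
theorem EF.fin_oo {K : ℕ} (hK : 2 ^ k ≤ K + 1) : EF k (ordW (Fin K)) (ordW OO) := by
  induction k generalizing K with
  | zero => trivial
  | succ k ih =>
    have h2 : 2 ^ (k + 1) = 2 * 2 ^ k := by ring
    have hk : 1 ≤ 2 ^ k := Nat.one_le_two_pow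
    have hfin : ∀ {a b : ℕ}, 2 ^ k ≤ a + 1 → 2 ^ k ≤ b + 1 →
        EF k (ordW (Fin a)) (ordW (Fin b)) := fun ha hb => (ih ha).trans (ih hb).symm
    have hl : ∀ (i : Fin K) (j : ℕ), EF k (ordW (Fin i)) (ordW (Fin j)) →
        2 ^ k ≤ K - 1 - i + 1 →
        EF k ((ordW (Fin K)).restrict {r | r < i})
          ((ordW OO).restrict {r | r < (toLex (Sum.inl j) : OO)}) ∧
        EF k ((ordW (Fin K)).restrict {r | i < r})
          ((ordW OO).restrict {r | (toLex (Sum.inl j) : OO) < r}) := fun i j h h' =>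
      ⟨((fin_restrict_lt i).EF.symm.trans h).trans (oo_restrict_lt_inl j).EF,
        ((fin_restrict_gt i).EF.symm.trans (ih h')).trans (oo_restrict_gt_inl j).EF⟩
    have hr : ∀ (i : Fin K) (j : ℕ), EF k (ordW (Fin (K - 1 - i))) (ordW (Fin j)) →
        2 ^ k ≤ (i : ℕ) + 1 →
        EF k ((ordW (Fin K)).restrict {r | r < i})
          ((ordW OO).restrict {r | r < (toLex (Sum.inr (OrderDual.toDual j)) : OO)}) ∧
        EF k ((ordW (Fin K)).restrict {r | i < r})
          ((ordW OO).restrict {r | (toLex (Sum.inr (OrderDual.toDual j)) : OO) < r}) :=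
      fun i j h h' =>
      ⟨((fin_restrict_lt i).EF.symm.trans (ih h')).trans (oo_restrict_lt_inr j).EF,
        ((fin_restrict_gt i).EF.symm.trans h).trans (oo_restrict_gt_inr j).EF⟩
    constructor
    · intro i
      change Fin K at i
      by_cases hi : 2 ^ k ≤ K - 1 - i + 1
      · exact ⟨(toLex (Sum.inl (i : ℕ)) : OO), rfl, hl i i (EF.refl _ _) hi⟩
      · exact ⟨(toLex (Sum.inr (OrderDual.toDual (K - 1 - i : ℕ))) : OO), rfl,
          hr i _ (EF.refl _ _) (by omega)⟩
    · rintro (j | j)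
      · by_cases hj : j < 2 ^ k
        · exact ⟨(⟨j, by omega⟩ : Fin K), rfl, hl ⟨j, by omega⟩ j (EF.refl _ _)
            (show 2 ^ k ≤ K - 1 - j + 1 by omega)⟩
        · exact ⟨(⟨2 ^ k - 1, by omega⟩ : Fin K), rfl, hl ⟨2 ^ k - 1, by omega⟩ j
            (hfin (show 2 ^ k ≤ 2 ^ k - 1 + 1 by omega) (by omega))
            (show 2 ^ k ≤ K - 1 - (2 ^ k - 1) + 1 by omega)⟩
      · change ℕ at j
        by_cases hj : j < 2 ^ k
        · refine ⟨(⟨K - 1 - j, by omega⟩ : Fin K), rfl, hr ⟨K - 1 - j, by omega⟩ j ?_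
            (show 2 ^ k ≤ K - 1 - j + 1 by omega)⟩
          have : K - 1 - (K - 1 - j) = j := by omega
          exact this.symm ▸ EF.refl _ _
        · exact ⟨(⟨K - 2 ^ k, by omega⟩ : Fin K), rfl, hr ⟨K - 2 ^ k, by omega⟩ j
            (hfin (show 2 ^ k ≤ K - 1 - (K - 2 ^ k) + 1 by omega) (by omega))
            (show 2 ^ k ≤ K - 2 ^ k + 1 by omega)⟩

end Orders

end GWord

/-! ### Games and the relations `≡_{m,n}^X`, `≡_{m,n}^Y` -/

namespace GWord

variable {A : Type}

theorem EF.alph_eq {k : ℕ} {u v : GWord A} (h : EF (k + 1) u v) : u.alph = v.alph := by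
  ext a
  exact ⟨fun ⟨p, hp⟩ => (h.1 p).imp fun _ (hq : _ ∧ _) => hq.1.symm.trans hp,
    fun ⟨q, hq⟩ => (h.2 q).imp fun _ (hp : _ ∧ _) => hp.1.trans hq⟩

theorem mem_alph_restrict {u : GWord A} {s : Set u.P} {a : A} :
    a ∈ (u.restrict s).alph ↔ ∃ p ∈ s, u.w p = a :=
  ⟨fun ⟨p, hp⟩ => ⟨p.1, p.2, hp⟩, fun ⟨p, hs, hp⟩ => ⟨⟨p, hs⟩, hp⟩⟩

theorem isFirst_iff {u : GWord A} {a : A} {p : u.P} :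
    u.IsFirst a p ↔ u.w p = a ∧ a ∉ (u.restrict {q | q < p}).alph := by
  refine and_congr_right fun _ => ?_
  rw [mem_alph_restrict]
  exact ⟨fun h ⟨q, hq, hw⟩ => (h q hw).not_gt hq, fun h q hw => not_lt.1 fun hq => h ⟨q, hq, hw⟩⟩

theorem isLast_iff {u : GWord A} {a : A} {p : u.P} :
    u.IsLast a p ↔ u.w p = a ∧ a ∉ (u.restrict {q | p < q}).alph := by
  refine and_congr_right fun _ => ?_
  rw [mem_alph_restrict]
  exact ⟨fun h ⟨q, hq, hw⟩ => (h q hw).not_gt hq, fun h q hw => not_lt.1 fun hq => h ⟨q, hq, hw⟩⟩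

section Factors

variable {u v : GWord A} {a : A}

theorem IsFirst.unique {p q : u.P} (hp : u.IsFirst a p) (hq : u.IsFirst a q) : p = q :=
  le_antisymm (hp.2 q hq.1) (hq.2 p hp.1)

theorem IsLast.unique {p q : u.P} (hp : u.IsLast a p) (hq : u.IsLast a q) : p = q :=
  le_antisymm (hq.2 p hp.1) (hp.2 q hq.1)

theorem IsFirst.XL_eq {p : u.P} (hp : u.IsFirst a p) : u.XL a = u.restrict {q | q < p} := by
  have h : ∃ p, u.IsFirst a p := ⟨p, hp⟩
  rw [XL, dif_pos h, h.choose_spec.unique hp]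

theorem IsFirst.XR_eq {p : u.P} (hp : u.IsFirst a p) : u.XR a = u.restrict {q | p < q} := by
  have h : ∃ p, u.IsFirst a p := ⟨p, hp⟩
  rw [XR, dif_pos h, h.choose_spec.unique hp]

theorem IsLast.YL_eq {p : u.P} (hp : u.IsLast a p) : u.YL a = u.restrict {q | q < p} := by
  have h : ∃ p, u.IsLast a p := ⟨p, hp⟩
  rw [YL, dif_pos h, h.choose_spec.unique hp]

theorem IsLast.YR_eq {p : u.P} (hp : u.IsLast a p) : u.YR a = u.restrict {q | p < q} := by
  have h : ∃ p, u.IsLast a p := ⟨p, hp⟩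
  rw [YR, dif_pos h, h.choose_spec.unique hp]

variable {k : ℕ}

theorem EF.exists_isFirst {p : u.P} (h : EF (k + 2) u v) (hp : u.IsFirst a p) :
    ∃ q, v.IsFirst a q ∧ EF (k + 1) (u.restrict {r | r < p}) (v.restrict {r | r < q}) ∧
      EF (k + 1) (u.restrict {r | p < r}) (v.restrict {r | q < r}) := by
  obtain ⟨q, hw, h1, h2⟩ := h.1 p
  rw [isFirst_iff] at hp
  exact ⟨q, isFirst_iff.2 ⟨hw ▸ hp.1, h1.alph_eq ▸ hp.2⟩, h1, h2⟩

theorem EF.exists_isLast {p : u.P} (h : EF (k + 2) u v) (hp : u.IsLast a p) :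
    ∃ q, v.IsLast a q ∧ EF (k + 1) (u.restrict {r | r < p}) (v.restrict {r | r < q}) ∧
      EF (k + 1) (u.restrict {r | p < r}) (v.restrict {r | q < r}) := by
  obtain ⟨q, hw, h1, h2⟩ := h.1 p
  rw [isLast_iff] at hp
  exact ⟨q, isLast_iff.2 ⟨hw ▸ hp.1, h2.alph_eq ▸ hp.2⟩, h1, h2⟩

theorem EF.X_factors (h : EF (k + 2) u v) (a : A) :
    EF (k + 1) (u.XL a) (v.XL a) ∧ EF (k + 1) (u.XR a) (v.XR a) := by
  by_cases hu : ∃ p, u.IsFirst a p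
  · obtain ⟨p, hp⟩ := hu
    obtain ⟨q, hq, h1, h2⟩ := h.exists_isFirst hp
    rw [hp.XL_eq, hp.XR_eq, hq.XL_eq, hq.XR_eq]
    exact ⟨h1, h2⟩
  · have hv : ¬ ∃ q, v.IsFirst a q := fun ⟨_, hq⟩ =>
      hu ((h.symm.exists_isFirst hq).imp fun _ h => h.1)
    rw [XL, XL, XR, XR, dif_neg hu, dif_neg hv, dif_neg hu, dif_neg hv]
    exact ⟨h.of_succ, h.of_succ⟩

theorem EF.Y_factors (h : EF (k + 2) u v) (a : A) :
    EF (k + 1) (u.YL a) (v.YL a) ∧ EF (k + 1) (u.YR a) (v.YR a) := by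
  by_cases hu : ∃ p, u.IsLast a p
  · obtain ⟨p, hp⟩ := hu
    obtain ⟨q, hq, h1, h2⟩ := h.exists_isLast hp
    rw [hp.YL_eq, hp.YR_eq, hq.YL_eq, hq.YR_eq]
    exact ⟨h1, h2⟩
  · have hv : ¬ ∃ q, v.IsLast a q := fun ⟨_, hq⟩ =>
      hu ((h.symm.exists_isLast hq).imp fun _ h => h.1)
    rw [YL, YL, YR, YR, dif_neg hu, dif_neg hv, dif_neg hu, dif_neg hv]
    exact ⟨h.of_succ, h.of_succ⟩

end Factors

theorem EF.toEqvAux {n m : ℕ} {u v : GWord A} (h : EF (n + 1) u v) :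
    eqvAux n ZK.X m u v ∧ eqvAux n ZK.Y m u v := by
  induction n generalizing m u v with
  | zero => exact ⟨trivial, trivial⟩
  | succ n ih =>
    cases m with
    | zero => exact ⟨trivial, trivial⟩
    | succ m =>
      exact ⟨⟨h.alph_eq, (ih h.of_succ).2, fun a _ =>
          ⟨(ih (h.X_factors a).1).2, (ih (h.X_factors a).2).1⟩⟩,
        ⟨h.alph_eq, (ih h.of_succ).1, fun a _ =>
          ⟨(ih (h.Y_factors a).1).2, (ih (h.Y_factors a).2).1⟩⟩⟩

end GWord

section EqvAux

variable {A : Type}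

theorem eqvAux_trans {n m : ℕ} {u v x : GWord A} :
    (eqvAux n ZK.X m u v → eqvAux n ZK.X m v x → eqvAux n ZK.X m u x) ∧
      (eqvAux n ZK.Y m u v → eqvAux n ZK.Y m v x → eqvAux n ZK.Y m u x) := by
  induction n generalizing m u v x with
  | zero => exact ⟨fun _ _ => trivial, fun _ _ => trivial⟩
  | succ n ih =>
    cases m with
    | zero => exact ⟨fun _ _ => trivial, fun _ _ => trivial⟩
    | succ m =>
      exact ⟨fun ⟨h1, h2, h3⟩ ⟨h4, h5, h6⟩ => ⟨h1.trans h4, ih.2 h2 h5, fun a ha =>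
          ⟨ih.2 (h3 a ha).1 (h6 a (h1 ▸ ha)).1, ih.1 (h3 a ha).2 (h6 a (h1 ▸ ha)).2⟩⟩,
        fun ⟨h1, h2, h3⟩ ⟨h4, h5, h6⟩ => ⟨h1.trans h4, ih.1 h2 h5, fun a ha =>
          ⟨ih.2 (h3 a ha).1 (h6 a (h1 ▸ ha)).1, ih.1 (h3 a ha).2 (h6 a (h1 ▸ ha)).2⟩⟩⟩

theorem GWord.EF.eqvAux_congr {n m : ℕ} {u v u' v' : GWord A} (hu : GWord.EF (n + 1) u u')
    (hv : GWord.EF (n + 1) v v') :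
    (eqvAux n ZK.X m u v ↔ eqvAux n ZK.X m u' v') ∧
      (eqvAux n ZK.Y m u v ↔ eqvAux n ZK.Y m u' v') :=
  ⟨⟨fun h => eqvAux_trans.1 (eqvAux_trans.1 hu.symm.toEqvAux.1 h) hv.toEqvAux.1,
      fun h => eqvAux_trans.1 (eqvAux_trans.1 hu.toEqvAux.1 h) hv.symm.toEqvAux.1⟩,
    ⟨fun h => eqvAux_trans.2 (eqvAux_trans.2 hu.symm.toEqvAux.2 h) hv.toEqvAux.2,
      fun h => eqvAux_trans.2 (eqvAux_trans.2 hu.toEqvAux.2 h) hv.symm.toEqvAux.2⟩⟩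

end EqvAux

/-! ### Finite words -/

namespace GWord

variable {A : Type}

theorem alph_ofList (u : List A) : (ofList u).alph = {a | a ∈ u} := by
  ext a
  exact List.mem_iff_get.symm

theorem ofList_append (u v : List A) :
    Iso ((ofList u).append (ofList v)) (ofList (u ++ v)) := by
  refine ⟨fun r => Sum.elim
    (fun i : Fin u.length => (⟨i, by simp; omega⟩ : Fin (u ++ v).length))
    (fun j : Fin v.length => (⟨u.length + j, by simp⟩ : Fin (u ++ v).length)) (ofLex r),
    ?_, ?_, ?_⟩
  · rintro (a | a) (b | b) h
    · have h' : a < b := Sum.Lex.inl_lt_inl_iff.1 h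
      exact h'
    · exact Fin.lt_def.2 (lt_of_lt_of_le (Fin.isLt (n := u.length) a) (Nat.le_add_right _ _))
    · exact absurd h Sum.Lex.not_inr_lt_inl
    · have h' : a < b := Sum.Lex.inr_lt_inr_iff.1 h
      exact Fin.lt_def.2 (Nat.add_lt_add_left (Fin.lt_def.1 h') _)
  · intro q
    change Fin (u ++ v).length at q
    have hq : (q : ℕ) < u.length + v.length := q.isLt.trans_eq (by simp)
    by_cases h : (q : ℕ) < u.length
    · exact ⟨toLex (Sum.inl (⟨q, h⟩ : Fin u.length)), rfl⟩
    · exact ⟨toLex (Sum.inr (⟨q - u.length, by omega⟩ : Fin v.length)),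
        Fin.ext (show u.length + (q - u.length) = (q : ℕ) by omega)⟩
  · rintro (⟨a, ha⟩ | ⟨a, ha⟩)
    · exact List.getElem_append_left ha
    · exact (List.getElem_append_right (Nat.le_add_right _ _)).trans
        (by simp; rfl)

theorem gpow_fin_succ (u : GWord A) (K : ℕ) :
    Iso (u.append (u.gpow (Fin K))) (u.gpow (Fin (K + 1))) := by
  refine ⟨fun r => Sum.elim (fun p : u.P => (toLex (0, p) : Fin (K + 1) ×ₗ u.P))
    (fun x : Fin K ×ₗ u.P => (toLex ((ofLex x).1.succ, (ofLex x).2) : Fin (K + 1) ×ₗ u.P))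
    (ofLex r), ?_, ?_, ?_⟩
  · rintro (a | ⟨a, x⟩) (b | ⟨b, y⟩) h
    · have h' : a < b := Sum.Lex.inl_lt_inl_iff.1 h
      exact Prod.Lex.toLex_lt_toLex.2 (Or.inr ⟨rfl, h'⟩)
    · exact Prod.Lex.toLex_lt_toLex.2 (Or.inl (Fin.succ_pos b))
    · exact absurd h Sum.Lex.not_inr_lt_inl
    · have h1 : (toLex (a, x) : Fin K ×ₗ u.P) < toLex (b, y) := Sum.Lex.inr_lt_inr_iff.1 h
      exact Prod.Lex.toLex_lt_toLex.2 ((Prod.Lex.toLex_lt_toLex.1 h1).imp Fin.succ_lt_succ_iff.2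
        fun h => ⟨congrArg Fin.succ h.1, h.2⟩)
  · rintro ⟨i, p⟩
    induction i using Fin.cases with
    | zero => exact ⟨toLex (Sum.inl p), rfl⟩
    | succ i => exact ⟨toLex (Sum.inr (toLex (i, p))), rfl⟩
  · rintro (a | a) <;> rfl

theorem EF.listNPow_gpow (k : ℕ) (l : List A) (K : ℕ) :
    EF k (ofList (listNPow l K)) ((ofList l).gpow (Fin K)) := by
  induction K with
  | zero =>
    exact Iso.EF ⟨fun p : Fin 0 => p.elim0, fun p : Fin 0 => p.elim0, fun q => q.1.elim0,
      fun p : Fin 0 => p.elim0⟩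
  | succ K ih =>
    exact ((ofList_append l (listNPow l K)).EF.symm.trans ((EF.refl k _).append ih)).trans
      (gpow_fin_succ _ K).EF

theorem EF.substNat_substOO {k K : ℕ} (hK : 2 ^ k ≤ K + 1) (α : PiTerm A) :
    EF k (ofList (α.substNat K)) α.substOO := by
  induction α with
  | eps => exact EF.refl _ _
  | letter a => exact EF.refl _ _
  | mul α β ihα ihβ => exact (ofList_append _ _).EF.symm.trans (ihα.append ihβ)
  | pi γ ih => exact (EF.listNPow_gpow k _ K).trans ((EF.fin_oo hK).gpow ih)

section Split

variable (w z : List A) (a : A)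

/-- The position of `a` in the word `w ++ a :: z`. -/
def splitPos : (ofList (w ++ a :: z)).P :=
  (⟨w.length, by simp⟩ : Fin (w ++ a :: z).length)

theorem w_splitPos : (ofList (w ++ a :: z)).w (splitPos w z a) = a := by
  change (w ++ a :: z)[w.length]'_ = a
  simp

theorem restrict_lt_splitPos :
    Iso (ofList w) ((ofList (w ++ a :: z)).restrict {r | r < splitPos w z a}) :=
  iso_restrict (u := ofList w) (v := ofList (w ++ a :: z))
    (fun i : Fin w.length => (⟨i, by simp; omega⟩ : Fin (w ++ a :: z).length))
    (fun _ _ h => h) (fun i : Fin w.length => List.getElem_append_left i.isLt) fun q =>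
      ⟨fun h => ⟨(⟨Fin.val (n := (w ++ a :: z).length) q, h⟩ : Fin w.length), rfl⟩,
        fun ⟨r, hr⟩ => hr ▸ Fin.isLt (n := w.length) r⟩

theorem restrict_gt_splitPos :
    Iso (ofList z) ((ofList (w ++ a :: z)).restrict {r | splitPos w z a < r}) := by
  refine iso_restrict (u := ofList z) (v := ofList (w ++ a :: z))
    (fun i : Fin z.length => (⟨w.length + 1 + i, by simp; omega⟩ : Fin (w ++ a :: z).length))
    (fun a b h => Fin.lt_def.2 (Nat.add_lt_add_left (Fin.lt_def.1 h) _)) ?_ ?_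
  · rintro ⟨i, hi⟩
    change (w ++ a :: z)[w.length + 1 + i]'_ = z[i]
    rw [List.getElem_append_right (by omega)]
    simp [show w.length + 1 + i - w.length = i + 1 by omega]
  · intro q
    change Fin (w ++ a :: z).length at q
    have hq : (q : ℕ) < w.length + (z.length + 1) := q.isLt.trans_eq (by simp)
    constructor
    · intro h
      have h' : w.length < (q : ℕ) := h
      exact ⟨(⟨q - (w.length + 1), by omega⟩ : Fin z.length),
        Fin.ext (show w.length + 1 + (q - (w.length + 1)) = (q : ℕ) by omega)⟩
    · rintro ⟨r, rfl⟩
      exact Fin.lt_def.2 (show w.length < w.length + 1 + Fin.val (n := z.length) r by omega)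

variable {w z a}

theorem isFirst_splitPos (h : a ∉ w) : (ofList (w ++ a :: z)).IsFirst a (splitPos w z a) :=
  isFirst_iff.2 ⟨w_splitPos w z a, by
    rw [← (restrict_lt_splitPos w z a).EF.alph_eq (k := 0), alph_ofList]; exact h⟩

theorem isLast_splitPos (h : a ∉ z) : (ofList (w ++ a :: z)).IsLast a (splitPos w z a) :=
  isLast_iff.2 ⟨w_splitPos w z a, by
    rw [← (restrict_gt_splitPos w z a).EF.alph_eq (k := 0), alph_ofList]; exact h⟩

theorem EF.XL_ofList {k : ℕ} (h : a ∉ w) : EF k ((ofList (w ++ a :: z)).XL a) (ofList w) :=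
  (isFirst_splitPos h).XL_eq ▸ (restrict_lt_splitPos w z a).EF.symm

theorem EF.XR_ofList {k : ℕ} (h : a ∉ w) : EF k ((ofList (w ++ a :: z)).XR a) (ofList z) :=
  (isFirst_splitPos h).XR_eq ▸ (restrict_gt_splitPos w z a).EF.symm

theorem EF.YL_ofList {k : ℕ} (h : a ∉ z) : EF k ((ofList (w ++ a :: z)).YL a) (ofList w) :=
  (isLast_splitPos h).YL_eq ▸ (restrict_lt_splitPos w z a).EF.symm

theorem EF.YR_ofList {k : ℕ} (h : a ∉ z) : EF k ((ofList (w ++ a :: z)).YR a) (ofList z) :=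
  (isLast_splitPos h).YR_eq ▸ (restrict_gt_splitPos w z a).EF.symm

end Split

end GWord

open GWord in
theorem eqvAux_ofList_iff {A : Type} {n m : ℕ} {u v : List A} :
    (eqvAux n ZK.X m (ofList u) (ofList v) ↔ LEqv n m u v) ∧
      (eqvAux n ZK.Y m (ofList u) (ofList v) ↔ LEqv n m u.reverse v.reverse) := by
  induction n generalizing m u v with
  | zero => exact ⟨Iff.rfl, Iff.rfl⟩
  | succ n ih =>
    cases m with
    | zero => exact ⟨Iff.rfl, Iff.rfl⟩
    | succ m =>
      have hX : ∀ {a : A} {w z w' z' : List A}, a ∉ w → a ∉ w' →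
          ((eqvAux n ZK.Y m ((ofList (w ++ a :: z)).XL a) ((ofList (w' ++ a :: z')).XL a) ∧
            eqvAux n ZK.X (m + 1) ((ofList (w ++ a :: z)).XR a) ((ofList (w' ++ a :: z')).XR a)) ↔
            LEqv n m w.reverse w'.reverse ∧ LEqv n (m + 1) z z') := fun h h' =>
        and_congr (((EF.XL_ofList h).eqvAux_congr (EF.XL_ofList h')).2.trans ih.2)
          (((EF.XR_ofList h).eqvAux_congr (EF.XR_ofList h')).1.trans ih.1)
      have hY : ∀ {a : A} {w z w' z' : List A}, a ∉ z → a ∉ z' →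
          ((eqvAux n ZK.Y (m + 1) ((ofList (w ++ a :: z)).YL a) ((ofList (w' ++ a :: z')).YL a) ∧
            eqvAux n ZK.X m ((ofList (w ++ a :: z)).YR a) ((ofList (w' ++ a :: z')).YR a)) ↔
            LEqv n (m + 1) w.reverse w'.reverse ∧ LEqv n m z z') := fun h h' =>
        and_congr (((EF.YL_ofList h).eqvAux_congr (EF.YL_ofList h')).2.trans ih.2)
          (((EF.YR_ofList h).eqvAux_congr (EF.YR_ofList h')).1.trans ih.1)
      have halph : (ofList u).alph = (ofList v).alph ↔ ∀ a, a ∈ u ↔ a ∈ v := by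
        rw [alph_ofList, alph_ofList]
        exact Set.ext_iff
      constructor
      · refine (and_congr_right fun hal => and_congr ih.2 ⟨?_, ?_⟩).trans (and_congr_left' halph)
        · rintro h a w z w' z' rfl ha rfl ha'
          exact (hX ha ha').1 (h a (by rw [alph_ofList]; simp))
        · intro h a ha
          have hv : a ∈ v := by rwa [hal, alph_ofList] at ha
          rw [alph_ofList] at ha
          obtain ⟨w, z, rfl, hw⟩ := LEqv.exists_split ha
          obtain ⟨w', z', rfl, hw'⟩ := LEqv.exists_split hv
          exact (hX hw hw').2 (h a w z w' z' rfl hw rfl hw')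
      · have hrev : (∀ a, a ∈ u ↔ a ∈ v) ↔ ∀ a, a ∈ u.reverse ↔ a ∈ v.reverse := by simp
        refine (and_congr_right fun hal => and_congr (c := LEqv n m u.reverse.reverse
          v.reverse.reverse) ?_ ⟨?_, ?_⟩).trans (and_congr_left' (halph.trans hrev))
        · simpa using ih.1
        · intro h a w z w' z' hu ha hv ha'
          obtain rfl : u = z.reverse ++ a :: w.reverse := by simpa using congrArg List.reverse hu
          obtain rfl : v = z'.reverse ++ a :: w'.reverse := by simpa using congrArg List.reverse hv
          have := (hY (by simpa using ha) (by simpa using ha')).1 (h a (by rw [alph_ofList]; simp))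
          simpa [and_comm] using this
        · intro h a ha
          have hv : a ∈ v.reverse := by rw [hal, alph_ofList] at ha; simpa using ha
          have hu : a ∈ u.reverse := by rw [alph_ofList] at ha; simpa using ha
          obtain ⟨w, z, hu, hw⟩ := LEqv.exists_split hu
          obtain ⟨w', z', hv, hw'⟩ := LEqv.exists_split hv
          have := h a w z w' z' hu hw hv hw'
          obtain rfl : u = z.reverse ++ a :: w.reverse := by simpa using congrArg List.reverse hu
          obtain rfl : v = z'.reverse ++ a :: w'.reverse := by simpa using congrArg List.reverse hv
          exact (hY (by simpa using hw) (by simpa using hw')).2 (by simpa [and_comm] using this)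

theorem forall_wEquiv_substOO_iff {A : Type} {m : ℕ} {α β : PiTerm A} :
    (∀ n, wEquiv ZKind.X m n α.substOO β.substOO) ↔ PiTerm.EventuallyEqv m α β := by
  have key : ∀ n K, 2 ^ (n + 1) ≤ K + 1 → (LEqv n m (α.substNat K) (β.substNat K) ↔
      wEquiv ZKind.X m n α.substOO β.substOO) := fun n K hK =>
    eqvAux_ofList_iff.1.symm.trans ((GWord.EF.substNat_substOO hK α).eqvAux_congr
      (GWord.EF.substNat_substOO hK β)).1
  refine forall_congr' fun n => ⟨fun h => ⟨2 ^ (n + 1), fun K hK => (key n K (by omega)).2 h⟩,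
    fun ⟨K₀, h⟩ => ?_⟩
  exact (key n (max K₀ (2 ^ (n + 1))) (by omega)).1 (h _ (le_max_left _ _))

theorem PiTerm.wordVal_substNat_mul {A M : Type} [Monoid M] [Finite M] (f : A → M) (α : PiTerm A)
    {k : ℕ} (hk : 1 ≤ k) :
    wordVal f (α.substNat (monoidExp M * k)) = wordVal f (α.substNat (monoidExp M)) := by
  induction α with
  | eps => rfl
  | letter a => rfl
  | mul α β ihα ihβ => simp only [substNat, wordVal_append, ihα, ihβ]
  | pi γ ih =>
    simp only [substNat, wordVal_listNPow, ih]
    exact pow_eq_of_idempotent ((monoidExp_spec M).2 _) hk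

theorem not_separableByRm_of_eventuallyEqv {A : Type} {m : ℕ} (hm : 1 ≤ m) {M : Type} [Monoid M]
    [Finite M] {φ : FreeMonoid A →* M} {L₁ L₂ : Set (FreeMonoid A)} (hL₁ : L₁ = φ ⁻¹' (φ '' L₁))
    (hL₂ : L₂ = φ ⁻¹' (φ '' L₂)) {α β : PiTerm A} (h : PiTerm.EventuallyEqv m α β)
    (hα : FreeMonoid.ofList (α.substNat (monoidExp M)) ∈ L₁)
    (hβ : FreeMonoid.ofList (β.substNat (monoidExp M)) ∈ L₂) : ¬ SeparableByRm m L₁ L₂ := by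
  rintro ⟨N, iN, hfin, hN, ψ, S, hS, h1, h2⟩
  obtain ⟨m, rfl⟩ := Nat.exists_eq_add_of_le' hm
  obtain ⟨n, hn⟩ := InRLAux.exists_LEqv hN fun a => ψ (FreeMonoid.of a)
  obtain ⟨K₀, hK⟩ := h n
  have hle : K₀ ≤ monoidExp M * (K₀ + 1) :=
    (Nat.le_succ _).trans (Nat.le_mul_of_pos_left _ (monoidExp_spec M).1)
  have hstable : ∀ (γ : PiTerm A) (L : Set (FreeMonoid A)), L = φ ⁻¹' (φ '' L) →
      FreeMonoid.ofList (γ.substNat (monoidExp M)) ∈ L →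
      FreeMonoid.ofList (γ.substNat (monoidExp M * (K₀ + 1))) ∈ L := fun γ L hL hγ => by
    rw [hL]
    exact ⟨_, hγ, by
      rw [freeMonoidHom_apply, freeMonoidHom_apply,
        PiTerm.wordVal_substNat_mul _ γ (Nat.le_add_left 1 K₀)]⟩
  have hψ := hn _ _ (hK _ hle)
  rw [← freeMonoidHom_apply, ← freeMonoidHom_apply] at hψ
  have hS₂ : FreeMonoid.ofList (β.substNat (monoidExp M * (K₀ + 1))) ∈ S := by
    rw [hS]
    exact ⟨_, h1 (hstable α L₁ hL₁ hα), hψ⟩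
  exact Set.eq_empty_iff_forall_notMem.1 h2 _ ⟨hstable β L₂ hL₂ hβ, hS₂⟩

theorem exists_LEqv_of_not_separableByRm {A : Type} [Finite A] {m : ℕ} (hm : 1 ≤ m)
    {L₁ L₂ : Set (FreeMonoid A)} (h : ¬ SeparableByRm m L₁ L₂) (n : ℕ) :
    ∃ u v : List A, FreeMonoid.ofList u ∈ L₁ ∧ FreeMonoid.ofList v ∈ L₂ ∧ LEqv n m u v := by
  by_contra! hcon
  obtain ⟨m, rfl⟩ := Nat.exists_eq_add_of_le' hm
  refine h ⟨(LEqv.con A n (m + 1)).Quotient, inferInstance, inferInstance,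
    LEqv.inRLAux_con m n, (LEqv.con A n (m + 1)).mk',
    (LEqv.con A n (m + 1)).mk' ⁻¹' ((LEqv.con A n (m + 1)).mk' '' L₁), ?_,
    Set.subset_preimage_image _ _, ?_⟩
  · rw [Set.image_preimage_eq _ Con.mk'_surjective]
  · rw [Set.eq_empty_iff_forall_notMem]
    rintro v ⟨hv, u, hu, huv⟩
    exact hcon u.toList v.toList hu hv (LEqv.con_mk_eq.1 huv)

theorem exists_indistinguishable {A : Type} [Finite A] {m : ℕ} (hm : 1 ≤ m) {M : Type} [Monoid M]
    [Finite M] (f : A → M) {T₁ T₂ : Set M}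
    (h : ∀ n, ∃ u v : List A, wordVal f u ∈ T₁ ∧ wordVal f v ∈ T₂ ∧ LEqv n m u v) :
    ∃ B, ∃ s ∈ T₁, ∃ t ∈ T₂, Indistinguishable f m B s t := by
  obtain ⟨m, rfl⟩ := Nat.exists_eq_add_of_le' hm
  obtain ⟨⟨B, s, t⟩, hx⟩ := exists_forall_of_antitone
    (Q := fun n (x : Set A × T₁ × T₂) => ∃ u v, {a | a ∈ u} = x.1 ∧ {a | a ∈ v} = x.1 ∧
      wordVal f u = x.2.1 ∧ wordVal f v = x.2.2 ∧ LEqv n (m + 1) u v)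
    (fun n x ⟨u, v, h1, h2, h3, h4, h5⟩ => ⟨u, v, h1, h2, h3, h4, h5.of_succ⟩) fun n => by
      obtain ⟨u, v, hu, hv, huv⟩ := h (n + 1)
      exact ⟨({a | a ∈ u}, ⟨_, hu⟩, ⟨_, hv⟩), u, v, rfl, Set.ext fun a => (huv.mem_iff a).symm,
        rfl, rfl, huv.of_succ⟩
  exact ⟨B, s, s.2, t, t.2, hx⟩

/-- Theorem: inseparability by `R_m` is witnessed by π-terms. -/
theorem separation_by_Rm_witnessed_by_piTerms (A : Type) [Fintype A] (m : ℕ) (hm : 1 ≤ m)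
    (M : Type) [Monoid M] [Finite M] (φ : FreeMonoid A →* M)
    (L₁ L₂ : Set (FreeMonoid A))
    (hL₁ : L₁ = φ ⁻¹' (φ '' L₁)) (hL₂ : L₂ = φ ⁻¹' (φ '' L₂)) :
    ¬ SeparableByRm m L₁ L₂ ↔
      ∃ α β : PiTerm A,
        (∀ n : ℕ, wEquiv ZKind.X m n α.substOO β.substOO) ∧
        FreeMonoid.ofList (α.substNat (monoidExp M)) ∈ L₁ ∧
        FreeMonoid.ofList (β.substNat (monoidExp M)) ∈ L₂ := by

  simp only [forall_wEquiv_substOO_iff]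
  constructor
  · intro h
    have hmem : ∀ (L : Set (FreeMonoid A)) (u : List A), L = φ ⁻¹' (φ '' L) →
        (FreeMonoid.ofList u ∈ L ↔ wordVal (fun a => φ (FreeMonoid.of a)) u ∈ φ '' L) :=
      fun L u hL => by
        rw [← freeMonoidHom_apply]
        exact Set.ext_iff.1 hL _
    obtain ⟨B, s, hs, t, ht, hst⟩ := exists_indistinguishable hm (fun a => φ (FreeMonoid.of a))
      (T₁ := φ '' L₁) (T₂ := φ '' L₂) fun n => by
        obtain ⟨u, v, hu, hv, huv⟩ := exists_LEqv_of_not_separableByRm hm h n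
        exact ⟨u, v, (hmem _ u hL₁).1 hu, (hmem _ v hL₂).1 hv, huv⟩
    obtain ⟨α, β, -, -, rfl, rfl, hαβ⟩ := hst.realized (monoidExp M)
    exact ⟨α, β, hαβ, (hmem _ _ hL₁).2 hs, (hmem _ _ hL₂).2 ht⟩
  · rintro ⟨α, β, h, hα, hβ⟩
    exact not_separableByRm_of_eventuallyEqv hm hL₁ hL₂ h hα hβ
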